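/- arXiv:1211.0812 — 3 statements merged into one kernel-verified Lean document; each statement's English description precedes it below -/
import Mathlib

section
/- Let E be a Banach lattice and let A and B be positive compact linear operators on E such that the commutator C = AB − BA is also a positive operator. Then C is quasi-nilpotent (lim_{n→∞} ‖Cⁿ‖^{1/n} = 0) and ideal-triangularizable: there exists a chain of closed ideals of E, each invariant under C, which is a maximal chain in the lattice of all closed ideals of E. -/
open Filter Topology

/-- A closed ideal of a Banach lattice: a topologically closed linear subspace that is solid. -/
def IsClosedIdeal {E : Type*} [NormedAddCommGroup E] [Lattice E] [HasSolidNorm E] [IsOrderedAddMonoid E] [NormedSpace ℝ E]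
    (I : Submodule ℝ E) : Prop :=
  IsClosed (I : Set E) ∧ ∀ x y : E, |x| ≤ |y| → y ∈ I → x ∈ I

/-- A subspace `I` is invariant under an operator `T` if `T` maps `I` into `I`. -/
def InvariantUnder {E : Type*} [NormedAddCommGroup E] [Lattice E] [HasSolidNorm E] [IsOrderedAddMonoid E] [NormedSpace ℝ E]
    (T : E →L[ℝ] E) (I : Submodule ℝ E) : Prop :=
  ∀ x ∈ I, T x ∈ I

set_option linter.unusedSectionVars false

section BanachLattice

variable {E : Type*} [NormedAddCommGroup E] [Lattice E] [HasSolidNorm E] [IsOrderedAddMonoid E]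
  [NormedSpace ℝ E]

/-- Positivity of an operator on a normed lattice. -/
def IsPositiveOp (T : E →L[ℝ] E) : Prop := ∀ x : E, 0 ≤ x → 0 ≤ T x

theorem smul_nonneg_of_solid {c : ℝ} {x : E} (hc : 0 ≤ c) (hx : 0 ≤ x) : 0 ≤ c • x := by
  have dyadic : ∀ (k m : ℕ), 0 ≤ ((m : ℝ) / (2 : ℝ) ^ k) • x := by
    intro k
    induction k with
    | zero =>
      intro m
      simpa [Nat.cast_smul_eq_nsmul] using nsmul_nonneg hx m
    | succ k ih =>
      intro m
      apply nsmul_two_semiclosed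
      have := ih m
      convert! this using 1
      rw [← Nat.cast_smul_eq_nsmul ℝ, smul_smul]
      congr 1
      push_cast
      field_simp
      ring
  have h2 : Tendsto (fun k : ℕ => (2 : ℝ) ^ k) atTop atTop :=
    tendsto_pow_atTop_atTop_of_one_lt (by norm_num)
  have hlim := ((tendsto_nat_floor_mul_div_atTop hc).comp h2).smul_const x
  exact ge_of_tendsto' hlim fun k => dyadic k _

theorem smul_le_smul_of_solid {c : ℝ} {x y : E} (hc : 0 ≤ c) (hxy : x ≤ y) : c • x ≤ c • y := by
  rw [← sub_nonneg, ← smul_sub]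
  exact smul_nonneg_of_solid hc (sub_nonneg.2 hxy)

theorem abs_smul_le_of_solid (c : ℝ) (x : E) : |c • x| ≤ |c| • |x| := by
  rcases le_total 0 c with h | h
  · rw [abs_of_nonneg h, abs_le']
    refine ⟨smul_le_smul_of_solid h (le_abs_self x), ?_⟩
    rw [← smul_neg]
    exact smul_le_smul_of_solid h (neg_le_abs x)
  · rw [abs_of_nonpos h, abs_le']
    have h' : 0 ≤ -c := by linarith
    constructor
    · have := smul_le_smul_of_solid h' (neg_le_abs x)
      simpa using this
    · have := smul_le_smul_of_solid h' (le_abs_self x)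
      simpa using this

theorem norm_le_norm_of_nonneg_of_le {x y : E} (hx : 0 ≤ x) (hxy : x ≤ y) : ‖x‖ ≤ ‖y‖ :=
  norm_le_norm_of_abs_le_abs (by rwa [abs_of_nonneg hx, abs_of_nonneg (hx.trans hxy)])

/-- Truncation of `x` to the order interval `[-|y|, |y|]`. -/
theorem abs_truncation_le (x y : E) : |(x ⊓ |y|) ⊔ (-|y|)| ≤ |y| := by
  rw [abs_le']
  have h : -|y| ≤ |y| := (neg_nonpos.2 (abs_nonneg y)).trans (abs_nonneg y)
  exact ⟨sup_le inf_le_right h, neg_le.1 le_sup_right⟩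

theorem truncation_eq_self {x y : E} (h : |x| ≤ |y|) : (x ⊓ |y|) ⊔ (-|y|) = x := by
  rw [inf_eq_left.2 ((le_abs_self x).trans h), sup_eq_left]
  exact neg_le.1 ((neg_le_abs x).trans h)

namespace IsPositiveOp

variable {S T : E →L[ℝ] E}

theorem mono (hT : IsPositiveOp T) {x y : E} (h : x ≤ y) : T x ≤ T y := by
  rw [← sub_nonneg, ← map_sub]
  exact hT _ (sub_nonneg.2 h)

theorem abs_apply_le (hT : IsPositiveOp T) (x : E) : |T x| ≤ T |x| := by
  rw [abs_le']
  refine ⟨hT.mono (le_abs_self x), ?_⟩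
  rw [← map_neg]
  exact hT.mono (neg_le_abs x)

theorem norm_apply_le (hT : IsPositiveOp T) (x : E) : ‖T x‖ ≤ ‖T |x|‖ := by
  rw [← norm_abs_eq_norm (T x)]
  exact norm_le_norm_of_nonneg_of_le (abs_nonneg _) (hT.abs_apply_le x)

theorem mul (hS : IsPositiveOp S) (hT : IsPositiveOp T) : IsPositiveOp (S * T) :=
  fun x hx => hS _ (hT x hx)

theorem add (hS : IsPositiveOp S) (hT : IsPositiveOp T) : IsPositiveOp (S + T) :=
  fun x hx => add_nonneg (hS x hx) (hT x hx)

theorem one : IsPositiveOp (1 : E →L[ℝ] E) := fun _ hx => hx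

theorem smul (hT : IsPositiveOp T) {c : ℝ} (hc : 0 ≤ c) : IsPositiveOp (c • T) :=
  fun x hx => smul_nonneg_of_solid hc (hT x hx)

theorem pow (hT : IsPositiveOp T) (n : ℕ) : IsPositiveOp (T ^ n) := by
  induction n with
  | zero => exact one
  | succ n ih => rw [pow_succ]; exact ih.mul hT

theorem norm_le_of_sub (hS : IsPositiveOp S) (h : IsPositiveOp (T - S)) : ‖S‖ ≤ ‖T‖ := by
  refine S.opNorm_le_bound (norm_nonneg _) fun x => ?_
  have hST : S |x| ≤ T |x| := sub_nonneg.1 (h _ (abs_nonneg x))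
  calc ‖S x‖ ≤ ‖S |x|‖ := hS.norm_apply_le x
    _ ≤ ‖T |x|‖ := norm_le_norm_of_nonneg_of_le (hS _ (abs_nonneg x)) hST
    _ ≤ ‖T‖ * ‖x‖ := by rw [← norm_abs_eq_norm x]; exact T.le_opNorm _

theorem exists_inverse_one_sub [CompleteSpace E] (hT : IsPositiveOp T) (h : ‖T‖ < 1) :
    ∃ W : E →L[ℝ] E, IsPositiveOp W ∧ W * (1 - T) = 1 ∧ (1 - T) * W = 1 := by
  refine ⟨∑' n : ℕ, T ^ n, fun x hx => ?_, geom_series_mul_neg T h, mul_neg_geom_series T h⟩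
  have hs : HasSum (fun n : ℕ => (T ^ n) x) ((∑' n : ℕ, T ^ n) x) :=
    (ContinuousLinearMap.apply ℝ E x).hasSum (summable_geometric_of_norm_lt_one h).hasSum
  exact ge_of_tendsto' hs fun s => Finset.sum_nonneg fun n _ => hT.pow n x hx

end IsPositiveOp

/-- `V` is a positive resolvent of `T` at `a`. -/
def IsPosResolvent (T : E →L[ℝ] E) (a : ℝ) (V : E →L[ℝ] E) : Prop :=
  IsPositiveOp V ∧ V * (a • 1 - T) = 1 ∧ (a • 1 - T) * V = 1

namespace IsPosResolvent

variable {T V : E →L[ℝ] E} {a : ℝ}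

theorem mul_eq (h : IsPosResolvent T a V) : V * T = a • V - 1 := by
  have := h.2.1
  rw [mul_sub, mul_smul_comm, mul_one] at this
  rw [← this]; abel

theorem mul_eq' (h : IsPosResolvent T a V) : T * V = a • V - 1 := by
  have := h.2.2
  rw [sub_mul, smul_mul_assoc, one_mul] at this
  rw [← this]; abel

theorem norm_pow_le (h : IsPosResolvent T a V) (ha : 0 ≤ a) (hT : IsPositiveOp T) (n : ℕ) :
    ‖T ^ n‖ ≤ ‖V‖ * a ^ (n + 1) := by
  have key : IsPositiveOp (a ^ (n + 1) • V - T ^ n) := by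
    induction n with
    | zero =>
      have : a ^ (0 + 1) • V - T ^ 0 = V * T := by rw [h.mul_eq]; simp
      rw [this]
      exact h.1.mul hT
    | succ n ih =>
      have : a ^ (n + 1 + 1) • V - T ^ (n + 1)
          = (a ^ (n + 1) • V - T ^ n) * T + a ^ (n + 1) • (1 : E →L[ℝ] E) := by
        rw [sub_mul, smul_mul_assoc, h.mul_eq, pow_succ a (n + 1), pow_succ T, mul_smul, smul_sub]
        abel
      rw [this]
      exact (ih.mul hT).add (IsPositiveOp.one.smul (by positivity))
  calc ‖T ^ n‖ ≤ ‖a ^ (n + 1) • V‖ := (hT.pow n).norm_le_of_sub key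
    _ = ‖V‖ * a ^ (n + 1) := by
      rw [norm_smul, Real.norm_of_nonneg (by positivity), mul_comm]

theorem exists_of_norm_lt [CompleteSpace E] (hT : IsPositiveOp T) (h : ‖T‖ < a) :
    ∃ V, IsPosResolvent T a V := by
  have ha : 0 < a := (norm_nonneg T).trans_lt h
  have hn : ‖a⁻¹ • T‖ < 1 := by
    rw [norm_smul, norm_inv, Real.norm_of_nonneg ha.le, inv_mul_lt_iff₀ ha]
    simpa using h
  obtain ⟨W, hW, h1, h2⟩ := (hT.smul (inv_nonneg.2 ha.le)).exists_inverse_one_sub hn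
  have e : a • (1 : E →L[ℝ] E) - T = a • (1 - a⁻¹ • T) := by
    rw [smul_sub, smul_smul, mul_inv_cancel₀ ha.ne', one_smul]
  refine ⟨a⁻¹ • W, hW.smul (inv_nonneg.2 ha.le), ?_, ?_⟩
  · rw [e, smul_mul_smul_comm, h1, inv_mul_cancel₀ ha.ne', one_smul]
  · rw [e, smul_mul_smul_comm, h2, mul_inv_cancel₀ ha.ne', one_smul]

theorem exists_sub [CompleteSpace E] (h : IsPosResolvent T a V) {s : ℝ} (hs : 0 ≤ s)
    (hV : s * ‖V‖ < 1) : ∃ V', IsPosResolvent T (a - s) V' := by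
  have hn : ‖s • V‖ < 1 := by rwa [norm_smul, Real.norm_of_nonneg hs]
  obtain ⟨W, hW, h1, h2⟩ := (h.1.smul hs).exists_inverse_one_sub hn
  have e : (a - s) • (1 : E →L[ℝ] E) - T = (a • 1 - T) - s • 1 := by rw [sub_smul]; abel
  have e1 : W * V * ((a - s) • 1 - T) = 1 := by
    rw [e, mul_assoc, mul_sub, h.2.1, mul_smul_comm, mul_one, h1]
  have e2 : ((a - s) • 1 - T) * (V * W) = 1 := by
    rw [e, ← mul_assoc, sub_mul, h.2.2, smul_mul_assoc, one_mul, h2]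
  have e3 : W * V = V * W := left_inv_eq_right_inv e1 e2
  exact ⟨W * V, hW.mul h.1, e1, by rw [e3, e2]⟩

end IsPosResolvent

theorem continuous_abs_of_solid : Continuous fun z : E => |z| :=
  continuous_id.sup continuous_neg

theorem isClosedIdeal_topologicalClosure {I : Submodule ℝ E}
    (hI : ∀ x y : E, |x| ≤ |y| → y ∈ I → x ∈ I) : IsClosedIdeal I.topologicalClosure := by
  refine ⟨I.isClosed_topologicalClosure, fun x y hxy hy => ?_⟩
  have hcont : Continuous fun z : E => (x ⊓ |z|) ⊔ (-|z|) :=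
    (continuous_const.inf continuous_abs_of_solid).sup continuous_abs_of_solid.neg
  have hmaps : Set.MapsTo (fun z : E => (x ⊓ |z|) ⊔ (-|z|)) I I :=
    fun z hz => hI _ _ (abs_truncation_le x z) hz
  have : (x ⊓ |y|) ⊔ (-|y|) ∈ I.topologicalClosure := hmaps.closure hcont hy
  rwa [truncation_eq_self hxy] at this

theorem isClosedIdeal_bot : IsClosedIdeal (⊥ : Submodule ℝ E) := by
  refine ⟨by simp, fun x y hxy hy => ?_⟩
  rw [Submodule.mem_bot] at hy ⊢
  subst hy
  have := norm_le_norm_of_abs_le_abs hxy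
  simpa using this

theorem isClosedIdeal_top : IsClosedIdeal (⊤ : Submodule ℝ E) :=
  ⟨by simp, fun _ _ _ _ => trivial⟩

theorem IsClosedIdeal.abs_mem {I : Submodule ℝ E} (hI : IsClosedIdeal I) {x : E} (hx : x ∈ I) :
    |x| ∈ I := hI.2 _ _ (abs_abs x).le hx

theorem IsClosedIdeal.invariantUnder_of_le {I : Submodule ℝ E} (hI : IsClosedIdeal I)
    {S T : E →L[ℝ] E} (hS : IsPositiveOp S) (hTS : IsPositiveOp (T - S))
    (h : InvariantUnder T I) : InvariantUnder S I := by
  intro x hx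
  refine hI.2 _ (T |x|) ?_ (h _ (hI.abs_mem hx))
  have h1 : S |x| ≤ T |x| := sub_nonneg.1 (hTS _ (abs_nonneg x))
  exact ((hS.abs_apply_le x).trans h1).trans (le_abs_self _)

/-- The closed ideal generated by `u`. -/
def principalClosedIdeal (u : E) : Submodule ℝ E :=
  Submodule.topologicalClosure
    { carrier := {x | ∃ c : ℝ, 0 ≤ c ∧ |x| ≤ c • |u|}
      zero_mem' := ⟨0, le_rfl, by simp⟩
      add_mem' := by
        rintro x y ⟨c, hc, hx⟩ ⟨d, hd, hy⟩
        exact ⟨c + d, add_nonneg hc hd,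
          (abs_add_le x y).trans (by rw [add_smul]; exact add_le_add hx hy)⟩
      smul_mem' := by
        rintro a x ⟨c, hc, hx⟩
        refine ⟨|a| * c, by positivity, (abs_smul_le_of_solid a x).trans ?_⟩
        rw [mul_smul]
        exact smul_le_smul_of_solid (abs_nonneg a) hx }

theorem isClosedIdeal_principalClosedIdeal (u : E) : IsClosedIdeal (principalClosedIdeal u) :=
  isClosedIdeal_topologicalClosure fun _ _ hxy ⟨c, hc, hy⟩ => ⟨c, hc, hxy.trans hy⟩

theorem mem_principalClosedIdeal_of_le {u x : E} {c : ℝ} (hc : 0 ≤ c) (h : |x| ≤ c • |u|) :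
    x ∈ principalClosedIdeal u :=
  Submodule.le_topologicalClosure _ ⟨c, hc, h⟩

theorem exists_of_mem_principalClosedIdeal {u x : E} (hx : x ∈ principalClosedIdeal u) {δ : ℝ}
    (hδ : 0 < δ) : ∃ z : E, ‖x - z‖ < δ ∧ ∃ c : ℝ, 0 ≤ c ∧ |z| ≤ c • |u| := by
  obtain ⟨z, hz, hd⟩ := Metric.mem_closure_iff.1 hx δ hδ
  exact ⟨z, by rwa [← dist_eq_norm], hz⟩

theorem invariantUnder_principalClosedIdeal {T : E →L[ℝ] E} (hT : IsPositiveOp T) {u : E} {a : ℝ}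
    (ha : 0 ≤ a) (hu : T |u| ≤ a • |u|) : InvariantUnder T (principalClosedIdeal u) := by
  intro x hx
  refine Set.MapsTo.closure (s := {x | ∃ c : ℝ, 0 ≤ c ∧ |x| ≤ c • |u|})
    (t := {x | ∃ c : ℝ, 0 ≤ c ∧ |x| ≤ c • |u|}) ?_ T.continuous hx
  rintro z ⟨c, hc, hz⟩
  refine ⟨c * a, by positivity, (hT.abs_apply_le z).trans ((hT.mono hz).trans ?_)⟩
  rw [map_smul, mul_smul]
  exact smul_le_smul_of_solid hc hu

/-- Every closed ideal invariant under `T` is trivial. -/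
def IsIdealIrreducible (T : E →L[ℝ] E) : Prop :=
  ∀ K : Submodule ℝ E, IsClosedIdeal K → InvariantUnder T K → K = ⊥ ∨ K = ⊤

theorem IsIdealIrreducible.principalClosedIdeal_eq_top {T : E →L[ℝ] E} (h : IsIdealIrreducible T)
    (hT : IsPositiveOp T) {u : E} (hu0 : u ≠ 0) {a : ℝ} (ha : 0 ≤ a) (hu : T |u| ≤ a • |u|) :
    principalClosedIdeal u = ⊤ := by
  refine (h _ (isClosedIdeal_principalClosedIdeal u)
    (invariantUnder_principalClosedIdeal hT ha hu)).resolve_left fun hbot => hu0 ?_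
  have : u ∈ principalClosedIdeal u := mem_principalClosedIdeal_of_le zero_le_one (by simp)
  rwa [hbot, Submodule.mem_bot] at this

theorem IsIdealIrreducible.principalClosedIdeal_resolvent {T V : E →L[ℝ] E} {a : ℝ}
    (h : IsIdealIrreducible T) (hT : IsPositiveOp T) (ha : 0 ≤ a) (hV : IsPosResolvent T a V)
    {y : E} (hy : 0 ≤ y) (hy0 : y ≠ 0) : principalClosedIdeal (V y) = ⊤ := by
  have hVy : 0 ≤ V y := hV.1 y hy
  have e : T (V y) = a • V y - y := by
    have := congrArg (fun S : E →L[ℝ] E => S y) hV.mul_eq'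
    simpa using this
  refine h.principalClosedIdeal_eq_top hT (fun h0 => hy0 ?_) ha ?_
  · rw [h0] at e
    simpa using e
  · rw [abs_of_nonneg hVy, e]
    exact sub_le_self _ hy

/-- A nonzero positive compact operator without nontrivial closed invariant ideals is not
quasi-nilpotent. -/
theorem IsIdealIrreducible.eq_zero_of_forall_exists_resolvent {T : E →L[ℝ] E}
    (h : IsIdealIrreducible T) (hT : IsPositiveOp T) (hTc : IsCompactOperator T)
    (hq : ∀ ε > 0, ∃ a V, 0 < a ∧ a < ε ∧ IsPosResolvent T a V) : T = 0 := by
  by_contra hT0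
  obtain ⟨x₁, hx₁⟩ : ∃ x, T x ≠ 0 := by
    by_contra! hall
    exact hT0 (ContinuousLinearMap.ext hall)
  obtain ⟨x₀, hx₀, hTx₀⟩ : ∃ x : E, 0 ≤ x ∧ 0 < ‖T x‖ :=
    ⟨|x₁|, abs_nonneg _, (norm_pos_iff.2 hx₁).trans_le (hT.norm_apply_le x₁)⟩
  obtain ⟨a, R, ha, -, hR⟩ := hq 1 one_pos
  set δ : ℝ := ‖T x₀‖ / (2 * (‖T‖ + 1)) with hδ
  have hδ0 : 0 < δ := by positivity
  set U : Set E := {z | 0 ≤ z ∧ ‖x₀ - z‖ ≤ δ} with hU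
  set K : Set E := closure (T '' U) with hK
  have hKc : IsCompact K := by
    have hUb : Bornology.IsBounded U := by
      refine (Metric.isBounded_closedBall (x := x₀) (r := δ)).subset fun z hz => ?_
      rw [mem_closedBall_iff_norm, ← norm_neg, neg_sub]
      exact hz.2
    exact hTc.isCompact_closure_image_of_bounded (f := (T : E →ₗ[ℝ] E)) hUb
  have hKnn : ∀ y ∈ K, 0 ≤ y := by
    refine fun y hy => closure_minimal (s := T '' U) ?_ isClosed_nonneg hy
    rintro _ ⟨z, hz, rfl⟩
    exact hT z hz.1
  have hKnorm : ∀ y ∈ K, ‖T x₀‖ / 2 ≤ ‖y‖ := by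
    have hcl : IsClosed {y : E | ‖T x₀‖ / 2 ≤ ‖y‖} := isClosed_le continuous_const continuous_norm
    refine fun y hy => closure_minimal (s := T '' U) ?_ hcl hy
    rintro _ ⟨z, hz, rfl⟩
    have h1 : ‖T (x₀ - z)‖ ≤ ‖T x₀‖ / 2 := by
      calc ‖T (x₀ - z)‖ ≤ ‖T‖ * ‖x₀ - z‖ := T.le_opNorm _
        _ ≤ (‖T‖ + 1) * δ := by gcongr; exacts [by linarith, hz.2]
        _ = ‖T x₀‖ / 2 := by rw [hδ]; field_simp
    have h2 : ‖T x₀‖ ≤ ‖T (x₀ - z)‖ + ‖T z‖ := by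
      rw [map_sub]
      simpa using norm_add_le (T x₀ - T z) (T z)
    show ‖T x₀‖ / 2 ≤ ‖T z‖
    linarith
  obtain ⟨n, hn⟩ : ∃ n : ℕ, K ⊆ {y | ‖(x₀ - (n : ℝ) • R |y|) ⊔ 0‖ < δ} := by
    refine hKc.elim_directed_cover (fun n : ℕ => {y | ‖(x₀ - (n : ℝ) • R |y|) ⊔ 0‖ < δ}) ?_ ?_ ?_
    · intro n
      have hcont : Continuous fun y : E => (x₀ - (n : ℝ) • R |y|) ⊔ 0 :=
        (continuous_const.sub
          ((R.continuous.comp continuous_abs_of_solid).const_smul (n : ℝ))).sup continuous_const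
      exact isOpen_lt hcont.norm continuous_const
    · intro y hy
      have hy0 : y ≠ 0 := by
        have := hKnorm y hy
        exact norm_pos_iff.1 (by linarith)
      have hmem : x₀ ∈ principalClosedIdeal (R y) := by
        rw [h.principalClosedIdeal_resolvent hT ha.le hR (hKnn y hy) hy0]
        trivial
      obtain ⟨z, hz, c, hc, hzc⟩ := exists_of_mem_principalClosedIdeal hmem hδ0
      obtain ⟨n, hn⟩ := exists_nat_ge c
      refine Set.mem_iUnion.2 ⟨n, lt_of_le_of_lt ?_ hz⟩
      have hRy : 0 ≤ R y := hR.1 y (hKnn y hy)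
      rw [abs_of_nonneg hRy] at hzc
      rw [abs_of_nonneg (hKnn y hy)]
      refine norm_le_norm_of_abs_le_abs ?_
      rw [abs_of_nonneg le_sup_right]
      refine sup_le ?_ (abs_nonneg _)
      refine le_trans ?_ (le_abs_self _)
      refine sub_le_sub_left ((le_abs_self z).trans (hzc.trans ?_)) _
      rw [← sub_nonneg, ← sub_smul]
      exact smul_nonneg_of_solid (sub_nonneg.2 hn) hRy
    · refine Monotone.directed_le (f := fun n : ℕ => {y | ‖(x₀ - (n : ℝ) • R |y|) ⊔ 0‖ < δ}) ?_
      intro m n hmn y hy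
      refine lt_of_le_of_lt (norm_le_norm_of_nonneg_of_le le_sup_right ?_) hy
      refine sup_le_sup_right (sub_le_sub_left ?_ _) _
      rw [← sub_nonneg, ← sub_smul]
      refine smul_nonneg_of_solid (sub_nonneg.2 (by exact_mod_cast hmn)) (hR.1 _ (abs_nonneg y))
  set Φ : E → E := fun y => T (x₀ ⊓ (n : ℝ) • R y) with hΦ
  have hΦK : ∀ y ∈ K, Φ y ∈ K := by
    intro y hy
    have hRy : 0 ≤ (n : ℝ) • R y := smul_nonneg_of_solid n.cast_nonneg (hR.1 y (hKnn y hy))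
    refine subset_closure ⟨_, ⟨le_inf hx₀ hRy, ?_⟩, rfl⟩
    have h1 : ‖(x₀ - (n : ℝ) • R |y|) ⊔ 0‖ < δ := hn hy
    rw [abs_of_nonneg (hKnn y hy)] at h1
    have h2 : x₀ - x₀ ⊓ (n : ℝ) • R y = (x₀ - (n : ℝ) • R y) ⊔ 0 := by
      rw [sub_eq_add_neg, neg_inf, add_sup, sup_comm]
      congr 1
      · abel
      · abel
    rw [h2]
    exact h1.le
  have hTx₀K : T x₀ ∈ K := subset_closure ⟨x₀, ⟨hx₀, by simpa using hδ0.le⟩, rfl⟩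
  have hiter : ∀ k : ℕ, Φ^[k] (T x₀) ∈ K ∧
      Φ^[k] (T x₀) ≤ (n : ℝ) ^ k • (T ^ k * R ^ k) (T x₀) := by
    intro k
    induction k with
    | zero => exact ⟨hTx₀K, by simp⟩
    | succ k ih =>
      rw [Function.iterate_succ_apply']
      refine ⟨hΦK _ ih.1, ?_⟩
      have hcomm : Commute R T := by
        show R * T = T * R
        rw [hR.mul_eq, hR.mul_eq']
      have e : (n : ℝ) ^ (k + 1) • (T ^ (k + 1) * R ^ (k + 1)) (T x₀)
          = T ((n : ℝ) • R ((n : ℝ) ^ k • (T ^ k * R ^ k) (T x₀))) := by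
        have : T ^ (k + 1) * R ^ (k + 1) = T * (R * (T ^ k * R ^ k)) := by
          rw [pow_succ', pow_succ', ← mul_assoc R, (hcomm.pow_right k).eq]
          simp only [mul_assoc]
        rw [this, pow_succ', mul_smul]
        simp
      rw [e]
      exact hT.mono (inf_le_right.trans
        (smul_le_smul_of_solid n.cast_nonneg (hR.1.mono ih.2)))
  obtain ⟨ε, hε0, hε⟩ : ∃ ε > 0, ε * ((n : ℝ) * ‖R‖) ≤ 1 / 2 := by
    refine ⟨1 / (2 * ((n : ℝ) * ‖R‖ + 1)), by positivity, ?_⟩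
    rw [div_mul_eq_mul_div, div_le_div_iff₀ (by positivity) (by positivity)]
    linarith
  obtain ⟨b, V, hb, hbε, hV⟩ := hq ε hε0
  have hbound : ∀ k : ℕ, ‖T x₀‖ / 2 ≤ ‖V‖ * b * ‖T x₀‖ * (1 / 2) ^ k := by
    intro k
    calc ‖T x₀‖ / 2 ≤ ‖Φ^[k] (T x₀)‖ := hKnorm _ (hiter k).1
      _ ≤ ‖(n : ℝ) ^ k • (T ^ k * R ^ k) (T x₀)‖ :=
        norm_le_norm_of_nonneg_of_le (hKnn _ (hiter k).1) (hiter k).2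
      _ = (n : ℝ) ^ k * ‖(T ^ k * R ^ k) (T x₀)‖ := by
        rw [norm_smul, Real.norm_of_nonneg (by positivity)]
      _ ≤ (n : ℝ) ^ k * ((‖V‖ * b ^ (k + 1)) * ‖R‖ ^ k * ‖T x₀‖) := by
        have h0 : ‖T ^ k * R ^ k‖ ≤ (‖V‖ * b ^ (k + 1)) * ‖R‖ ^ k := by
          refine (norm_mul_le _ _).trans ?_
          have h1 := hV.norm_pow_le hb.le hT k
          have h2 : ‖R ^ k‖ ≤ ‖R‖ ^ k := by
            rcases k.eq_zero_or_pos with rfl | hk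
            · rw [pow_zero, pow_zero]
              exact ContinuousLinearMap.norm_id_le
            · exact norm_pow_le' R hk
          gcongr
        gcongr
        exact ((T ^ k * R ^ k).le_opNorm _).trans (by gcongr)
      _ = ‖V‖ * b * ‖T x₀‖ * (b * ((n : ℝ) * ‖R‖)) ^ k := by
        rw [mul_pow, mul_pow, pow_succ]; ring
      _ ≤ ‖V‖ * b * ‖T x₀‖ * (1 / 2) ^ k := by
        have : b * ((n : ℝ) * ‖R‖) ≤ 1 / 2 := le_trans (by gcongr) hε
        gcongr
  have hlim : Tendsto (fun k : ℕ => ‖V‖ * b * ‖T x₀‖ * (1 / 2 : ℝ) ^ k) atTop (𝓝 0) := by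
    have := (tendsto_pow_atTop_nhds_zero_of_lt_one (r := (1 / 2 : ℝ)) (by norm_num)
      (by norm_num)).const_mul (‖V‖ * b * ‖T x₀‖)
    simpa using this
  have := ge_of_tendsto' hlim hbound
  linarith

/-- If `E` has no nontrivial closed ideals invariant under the positive compact operator `T`, and
`A` is positive, then the commutator `A * T - T * A` can only be positive if it vanishes. -/
theorem IsIdealIrreducible.commutator_eq_zero [CompleteSpace E] {T A : E →L[ℝ] E}
    (h : IsIdealIrreducible T) (hT : IsPositiveOp T) (hTc : IsCompactOperator T)
    (hA : IsPositiveOp A) (hC : IsPositiveOp (A * T - T * A)) : A * T - T * A = 0 := by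
  set Λ : Set ℝ := {a | 0 < a ∧ ∃ V, IsPosResolvent T a V} with hΛ
  have hΛne : Λ.Nonempty :=
    ⟨‖T‖ + 1, by positivity, IsPosResolvent.exists_of_norm_lt hT (lt_add_one _)⟩
  have hΛbdd : BddBelow Λ := ⟨0, fun a ha => ha.1.le⟩
  set r : ℝ := sInf Λ with hr
  have hr0 : 0 ≤ r := le_csInf hΛne fun a ha => ha.1.le
  rcases hr0.eq_or_lt with hr0 | hr0
  · have hT0 : T = 0 := by
      refine h.eq_zero_of_forall_exists_resolvent hT hTc fun ε hε => ?_
      obtain ⟨a, ⟨ha, V, hV⟩, hlt⟩ := exists_lt_of_csInf_lt hΛne (show sInf Λ < ε by linarith)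
      exact ⟨a, V, ha, hlt, hV⟩
    simp [hT0]
  -- Resolvents close to the bottom `r` of `Λ` have large norm.
  have hstep : ∀ k : ℕ, ∃ a V, r ≤ a ∧ a < r + 1 / (k + 1) ∧ IsPosResolvent T a V ∧
      (k : ℝ) + 1 ≤ ‖V‖ := by
    intro k
    obtain ⟨s, hs0, hs1, hs2⟩ : ∃ s : ℝ, 0 < s ∧ s < r ∧ s * (k + 1) < 1 := by
      refine ⟨min (r / 2) (1 / (2 * (k + 1))), by positivity,
        (min_le_left _ _).trans_lt (by linarith), ?_⟩
      calc min (r / 2) (1 / (2 * ((k : ℝ) + 1))) * (k + 1) ≤ 1 / (2 * ((k : ℝ) + 1)) * (k + 1) := by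
            gcongr; exact min_le_right _ _
        _ = 1 / 2 := by field_simp
        _ < 1 := by norm_num
    have hsk : s < 1 / ((k : ℝ) + 1) := by rwa [lt_div_iff₀ (by positivity)]
    obtain ⟨a, ⟨ha, V, hV⟩, hlt⟩ := exists_lt_of_csInf_lt hΛne (show sInf Λ < r + s by linarith)
    have hra : r ≤ a := csInf_le hΛbdd ⟨ha, V, hV⟩
    refine ⟨a, V, hra, by linarith, hV, ?_⟩
    by_contra! hlt'
    obtain ⟨V', hV'⟩ := hV.exists_sub hs0.le
      (lt_of_le_of_lt (by gcongr) hs2)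
    have : r ≤ a - s := csInf_le hΛbdd ⟨by linarith, V', hV'⟩
    linarith
  choose a V hra har hV hVk using hstep
  have hVpos : ∀ k, 0 < ‖V k‖ := fun k => lt_of_lt_of_le (by positivity) (hVk k)
  set μ : ℕ → ℝ := fun k => ‖V k‖⁻¹ with hμ
  have hμ0 : ∀ k, 0 ≤ μ k := fun k => inv_nonneg.2 (norm_nonneg _)
  have hμlim : Tendsto μ atTop (𝓝 0) :=
    squeeze_zero hμ0
      (fun k => by simpa using inv_anti₀ (by positivity) (hVk k))
      (tendsto_one_div_add_atTop_nhds_zero_nat (𝕜 := ℝ))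
  have halim : Tendsto a atTop (𝓝 r) := by
    refine tendsto_of_tendsto_of_tendsto_of_le_of_le tendsto_const_nhds ?_ hra fun k => (har k).le
    simpa using (tendsto_one_div_add_atTop_nhds_zero_nat (𝕜 := ℝ)).const_add r
  set N : ℕ → E →L[ℝ] E := fun k => μ k • V k with hN
  have hNpos : ∀ k, IsPositiveOp (N k) := fun k => (hV k).1.smul (hμ0 k)
  have hNnorm : ∀ k, ‖N k‖ = 1 := fun k => by
    rw [hN, norm_smul, Real.norm_of_nonneg (hμ0 k), inv_mul_cancel₀ (hVpos k).ne']
  have hNle : ∀ k x, ‖N k x‖ ≤ ‖x‖ := fun k x => by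
    simpa [hNnorm k] using (N k).le_opNorm x
  have hNT : ∀ k, N k * T = a k • N k - μ k • 1 := fun k => by
    rw [hN, smul_mul_assoc, (hV k).mul_eq, smul_sub, smul_comm]
  have hTN : ∀ k, T * N k = a k • N k - μ k • 1 := fun k => by
    rw [hN, mul_smul_comm, (hV k).mul_eq', smul_sub, smul_comm]
  have hu : ∀ k, ∃ u : E, 0 ≤ u ∧ ‖u‖ ≤ 1 ∧ 1 / 2 ≤ ‖N k u‖ := fun k => by
    obtain ⟨x, hx1, hx2⟩ := (N k).exists_lt_apply_of_lt_opNorm (r := 1 / 2)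
      (by rw [hNnorm k]; norm_num)
    exact ⟨|x|, abs_nonneg x, by rw [norm_abs_eq_norm]; exact hx1.le,
      hx2.le.trans ((hNpos k).norm_apply_le x)⟩
  choose u hu0 hu1 hu2 using hu
  -- Along a subsequence both `T (N k (u k))` and `T (u k)` converge.
  have hcpt : IsCompact (closure (T '' Metric.closedBall (0 : E) 1)) :=
    hTc.isCompact_closure_image_closedBall (f := (T : E →ₗ[ℝ] E)) 1
  have hmem : ∀ k, (T (N k (u k)), T (u k)) ∈
      closure (T '' Metric.closedBall (0 : E) 1) ×ˢ closure (T '' Metric.closedBall (0 : E) 1) := by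
    refine fun k => ⟨subset_closure ⟨_, ?_, rfl⟩, subset_closure ⟨_, ?_, rfl⟩⟩
    · simpa using (hNle k (u k)).trans (hu1 k)
    · simpa using hu1 k
  obtain ⟨⟨w, t⟩, -, φ, hφ, hlim⟩ := (hcpt.prod hcpt).tendsto_subseq hmem
  have hφt := hφ.tendsto_atTop
  have hw : Tendsto (fun k => T (N (φ k) (u (φ k)))) atTop (𝓝 w) :=
    (continuous_fst.tendsto _).comp hlim
  have ht : Tendsto (fun k => T (u (φ k))) atTop (𝓝 t) := (continuous_snd.tendsto _).comp hlim
  have hμφ := hμlim.comp hφt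
  have haφ := halim.comp hφt
  have hμu : Tendsto (fun k => μ (φ k) • u (φ k)) atTop (𝓝 0) := by
    refine squeeze_zero_norm (fun k => ?_) hμφ
    rw [norm_smul, Real.norm_of_nonneg (hμ0 _)]
    exact mul_le_of_le_one_right (hμ0 _) (hu1 _)
  set x : E := r⁻¹ • w with hx
  have hxlim : Tendsto (fun k => N (φ k) (u (φ k))) atTop (𝓝 x) := by
    have h1 := (haφ.inv₀ hr0.ne').smul (hw.add hμu)
    rw [add_zero] at h1
    refine h1.congr fun k => ?_
    have e := congrArg (fun S : E →L[ℝ] E => S (u (φ k))) (hTN (φ k))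
    have e' : T (N (φ k) (u (φ k))) = a (φ k) • N (φ k) (u (φ k)) - μ (φ k) • u (φ k) := by
      simpa using e
    have hak : a (φ k) ≠ 0 := (hr0.trans_le (hra _)).ne'
    rw [e', sub_add_cancel, Function.comp_apply, smul_smul, inv_mul_cancel₀ hak, one_smul]
  have hx0 : 0 ≤ x := ge_of_tendsto' hxlim fun k => hNpos _ _ (hu0 _)
  have hxnorm : 1 / 2 ≤ ‖x‖ := ge_of_tendsto' hxlim.norm fun k => hu2 _
  have hxne : x ≠ 0 := norm_pos_iff.1 (by linarith)
  have hTx : T x = r • x := by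
    rw [hx, smul_smul, mul_inv_cancel₀ hr0.ne', one_smul]
    exact tendsto_nhds_unique ((T.continuous.tendsto _).comp hxlim) hw
  -- The closed invariant ideal of vectors annihilated in the limit by the normalized resolvents.
  let Z : Submodule ℝ E :=
    { carrier := {y | Tendsto (fun k => N (φ k) |y|) atTop (𝓝 0)}
      zero_mem' := by simp
      add_mem' := by
        intro y z hy hz
        have h1 : Tendsto (fun k => N (φ k) |y| + N (φ k) |z|) atTop (𝓝 0) := by
          simpa using hy.add hz
        refine squeeze_zero_norm (fun k => ?_) (tendsto_zero_iff_norm_tendsto_zero.1 h1)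
        refine norm_le_norm_of_nonneg_of_le (hNpos _ _ (abs_nonneg _)) ?_
        rw [← map_add]
        exact (hNpos _).mono (abs_add_le y z)
      smul_mem' := by
        intro c y hy
        have h1 : Tendsto (fun k => |c| • N (φ k) |y|) atTop (𝓝 0) := by
          simpa using hy.const_smul |c|
        refine squeeze_zero_norm (fun k => ?_) (tendsto_zero_iff_norm_tendsto_zero.1 h1)
        refine norm_le_norm_of_nonneg_of_le (hNpos _ _ (abs_nonneg _)) ?_
        rw [← map_smul]
        exact (hNpos _).mono (abs_smul_le_of_solid c y) }
  have hZmem : ∀ y, y ∈ Z ↔ Tendsto (fun k => N (φ k) |y|) atTop (𝓝 0) := fun y => Iff.rfl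
  have hZsolid : ∀ y z : E, |y| ≤ |z| → z ∈ Z → y ∈ Z := by
    intro y z hyz hz
    refine squeeze_zero_norm (fun k => ?_) (tendsto_zero_iff_norm_tendsto_zero.1 hz)
    exact norm_le_norm_of_nonneg_of_le (hNpos _ _ (abs_nonneg _)) ((hNpos _).mono hyz)
  have hZclosed : IsClosed (Z : Set E) := by
    refine isClosed_of_closure_subset fun y hy => ?_
    refine (hZmem y).2 (Metric.tendsto_atTop.2 fun ε hε => ?_)
    obtain ⟨z, hz, hyz⟩ := Metric.mem_closure_iff.1 hy (ε / 2) (by positivity)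
    obtain ⟨k₀, hk₀⟩ := Metric.tendsto_atTop.1 ((hZmem z).1 hz) (ε / 2) (by positivity)
    refine ⟨k₀, fun k hk => ?_⟩
    have h1 := hk₀ k hk
    rw [dist_zero_right] at h1 ⊢
    have h2 : ‖N (φ k) (|y| - |z|)‖ < ε / 2 :=
      ((hNle _ _).trans (norm_abs_sub_abs y z)).trans_lt (by rwa [← dist_eq_norm])
    calc ‖N (φ k) |y|‖ = ‖N (φ k) (|y| - |z|) + N (φ k) |z|‖ := by simp
      _ ≤ ‖N (φ k) (|y| - |z|)‖ + ‖N (φ k) |z|‖ := norm_add_le _ _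
      _ < ε := by linarith
  have hZT : InvariantUnder T Z := by
    intro y hy
    have h1 : Tendsto (fun k => T (N (φ k) |y|)) atTop (𝓝 0) := by
      simpa [Function.comp_def] using (T.continuous.tendsto 0).comp ((hZmem y).1 hy)
    refine squeeze_zero_norm (fun k => ?_) (tendsto_zero_iff_norm_tendsto_zero.1 h1)
    have e : T (N (φ k) |y|) = N (φ k) (T |y|) := by
      have := congrArg (fun S : E →L[ℝ] E => S |y|) ((hTN (φ k)).trans (hNT (φ k)).symm)
      simpa using this
    rw [e]
    exact norm_le_norm_of_nonneg_of_le (hNpos _ _ (abs_nonneg _))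
      ((hNpos _).mono (hT.abs_apply_le y))
  have ht0 : 0 ≤ t := ge_of_tendsto' ht fun k => hT _ (hu0 _)
  have hZne : Z ≠ ⊤ := by
    intro hZ
    have htZ : Tendsto (fun k => N (φ k) t) atTop (𝓝 0) := by
      have : t ∈ Z := by rw [hZ]; trivial
      rwa [hZmem, abs_of_nonneg ht0] at this
    have h1 : Tendsto (fun k => N (φ k) (T (u (φ k)) - t)) atTop (𝓝 0) :=
      squeeze_zero_norm (fun k => hNle _ _) (tendsto_iff_norm_sub_tendsto_zero.1 ht)
    have h2 : Tendsto (fun k => a (φ k) • N (φ k) (u (φ k))) atTop (𝓝 0) := by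
      have h3 := (h1.add htZ).add hμu
      rw [add_zero, add_zero] at h3
      refine h3.congr fun k => ?_
      have e := congrArg (fun S : E →L[ℝ] E => S (u (φ k))) (hNT (φ k))
      have e' : N (φ k) (T (u (φ k))) = a (φ k) • N (φ k) (u (φ k)) - μ (φ k) • u (φ k) := by
        simpa using e
      rw [map_sub, sub_add_cancel, e', sub_add_cancel]
    have h4 := tendsto_nhds_unique (haφ.smul hxlim) h2
    exact (smul_ne_zero hr0.ne' hxne) h4
  have hZbot : Z = ⊥ := (h Z ⟨hZclosed, hZsolid⟩ hZT).resolve_right hZne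
  set C : E →L[ℝ] E := A * T - T * A with hCdef
  have hVCV : ∀ k, V k * C * V k = A * V k - V k * A := fun k => by
    have : V k * C * V k = V k * A * (T * V k) - (V k * T) * (A * V k) := by
      rw [hCdef]; noncomm_ring
    rw [this, (hV k).mul_eq, (hV k).mul_eq', mul_sub, sub_mul, mul_smul_comm, smul_mul_assoc,
      mul_one, one_mul, mul_assoc]
    abel
  have hNCN : Tendsto (fun k => N (φ k) (C (N (φ k) (u (φ k))))) atTop (𝓝 0) := by
    have h1 : Tendsto (fun k => μ (φ k) • A (N (φ k) (u (φ k)))) atTop (𝓝 0) := by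
      simpa using hμφ.smul ((A.continuous.tendsto x).comp hxlim)
    refine squeeze_zero_norm (fun k => ?_) (tendsto_zero_iff_norm_tendsto_zero.1 h1)
    refine norm_le_norm_of_nonneg_of_le (hNpos _ _ (hC _ (hNpos _ _ (hu0 _)))) ?_
    have e := congrArg (fun S : E →L[ℝ] E => S (u (φ k))) (hVCV (φ k))
    have e' : V (φ k) (C (V (φ k) (u (φ k)))) = A (V (φ k) (u (φ k))) - V (φ k) (A (u (φ k))) := by
      simpa using e
    have e'' : N (φ k) (C (N (φ k) (u (φ k))))
        = μ (φ k) • A (N (φ k) (u (φ k))) - μ (φ k) • μ (φ k) • V (φ k) (A (u (φ k))) := by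
      simp only [hN, smul_apply, map_smul]
      rw [e', smul_sub, smul_sub]
    rw [e'']
    exact sub_le_self _ (smul_nonneg_of_solid (hμ0 _)
      (smul_nonneg_of_solid (hμ0 _) ((hV _).1 _ (hA _ (hu0 _)))))
  have hCx : C x = 0 := by
    have : C x ∈ Z := by
      rw [hZmem, abs_of_nonneg (hC x hx0)]
      have h1 : Tendsto (fun k => N (φ k) (C (N (φ k) (u (φ k)) - x))) atTop (𝓝 0) := by
        refine squeeze_zero_norm (fun k => hNle _ _) ?_
        have h2 : Tendsto (fun k => C (N (φ k) (u (φ k)) - x)) atTop (𝓝 0) := by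
          have h3 := (C.continuous.tendsto _).comp (hxlim.sub_const x)
          rwa [sub_self, map_zero] at h3
        exact tendsto_zero_iff_norm_tendsto_zero.1 h2
      have h4 := hNCN.sub h1
      rw [sub_zero] at h4
      refine h4.congr fun k => ?_
      simp
    rwa [hZbot, Submodule.mem_bot] at this
  have htop := h.principalClosedIdeal_eq_top hT hxne hr0.le
    (by rw [abs_of_nonneg hx0, hTx])
  ext y
  have hy : y ∈ principalClosedIdeal x := by rw [htop]; trivial
  refine closure_minimal (t := {y : E | C y = 0}) ?_
    (isClosed_eq C.continuous continuous_const) hy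
  rintro z ⟨c, -, hz⟩
  have h1 : |C z| ≤ 0 := by
    refine (hC.abs_apply_le z).trans ((hC.mono hz).trans ?_)
    rw [abs_of_nonneg hx0, map_smul, hCx, smul_zero]
  have h2 := norm_le_norm_of_nonneg_of_le (abs_nonneg _) h1
  rw [norm_abs_eq_norm, norm_zero] at h2
  exact norm_le_zero_iff.1 h2

section Quotient

theorem sup_sub_sup_mem {J : Submodule ℝ E} (hJ : IsClosedIdeal J) {a a' b b' : E}
    (ha : a - a' ∈ J) (hb : b - b' ∈ J) : a ⊔ b - a' ⊔ b' ∈ J := by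
  have h1 : |a ⊔ b - a' ⊔ b| ≤ |a - a'| := abs_sup_sub_sup_le_abs _ _ _
  have h2 : |a' ⊔ b - a' ⊔ b'| ≤ |b - b'| := by
    rw [sup_comm a' b, sup_comm a' b']
    exact abs_sup_sub_sup_le_abs _ _ _
  have := J.add_mem (hJ.2 _ _ h1 ha) (hJ.2 _ _ h2 hb)
  rwa [sub_add_sub_cancel] at this

theorem inf_sub_inf_mem {J : Submodule ℝ E} (hJ : IsClosedIdeal J) {a a' b b' : E}
    (ha : a - a' ∈ J) (hb : b - b' ∈ J) : a ⊓ b - a' ⊓ b' ∈ J := by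
  have h1 : |a ⊓ b - a' ⊓ b| ≤ |a - a'| := abs_inf_sub_inf_le_abs _ _ _
  have h2 : |a' ⊓ b - a' ⊓ b'| ≤ |b - b'| := by
    rw [inf_comm a' b, inf_comm a' b']
    exact abs_inf_sub_inf_le_abs _ _ _
  have := J.add_mem (hJ.2 _ _ h1 ha) (hJ.2 _ _ h2 hb)
  rwa [sub_add_sub_cancel] at this

/-- The quotient of a normed lattice by a closed ideal is a lattice. -/
@[reducible]
noncomputable def quotientLattice {J : Submodule ℝ E} (hJ : IsClosedIdeal J) : Lattice (E ⧸ J) :=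
  letI : Max (E ⧸ J) := ⟨Quotient.map₂ (· ⊔ ·) fun _ _ ha _ _ hb => by
    rw [← Quotient.eq_iff_equiv] at ha hb ⊢
    exact (Submodule.Quotient.eq J).2
      (sup_sub_sup_mem hJ ((Submodule.Quotient.eq J).1 ha) ((Submodule.Quotient.eq J).1 hb))⟩
  letI : Min (E ⧸ J) := ⟨Quotient.map₂ (· ⊓ ·) fun _ _ ha _ _ hb => by
    rw [← Quotient.eq_iff_equiv] at ha hb ⊢
    exact (Submodule.Quotient.eq J).2
      (inf_sub_inf_mem hJ ((Submodule.Quotient.eq J).1 ha) ((Submodule.Quotient.eq J).1 hb))⟩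
  Lattice.mk'
    (by rintro ⟨a⟩ ⟨b⟩; exact congrArg (Submodule.Quotient.mk (p := J)) (sup_comm a b))
    (by rintro ⟨a⟩ ⟨b⟩ ⟨c⟩; exact congrArg (Submodule.Quotient.mk (p := J)) (sup_assoc a b c))
    (by rintro ⟨a⟩ ⟨b⟩; exact congrArg (Submodule.Quotient.mk (p := J)) (inf_comm a b))
    (by rintro ⟨a⟩ ⟨b⟩ ⟨c⟩; exact congrArg (Submodule.Quotient.mk (p := J)) (inf_assoc a b c))
    (by rintro ⟨a⟩ ⟨b⟩; exact congrArg (Submodule.Quotient.mk (p := J)) sup_inf_self)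
    (by rintro ⟨a⟩ ⟨b⟩; exact congrArg (Submodule.Quotient.mk (p := J)) inf_sup_self)

variable {J : Submodule ℝ E}

theorem mkQ_sup (hJ : IsClosedIdeal J) (a b : E) :
    letI := quotientLattice hJ
    J.mkQ (a ⊔ b) = J.mkQ a ⊔ J.mkQ b := rfl

theorem mkQ_inf (hJ : IsClosedIdeal J) (a b : E) :
    letI := quotientLattice hJ
    J.mkQ (a ⊓ b) = J.mkQ a ⊓ J.mkQ b := rfl

theorem mkQ_abs (hJ : IsClosedIdeal J) (a : E) :
    letI := quotientLattice hJ
    J.mkQ |a| = |J.mkQ a| := rfl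

theorem mkQ_le_mkQ (hJ : IsClosedIdeal J) {a b : E} (h : a ≤ b) :
    letI := quotientLattice hJ
    J.mkQ a ≤ J.mkQ b := by
  let := quotientLattice hJ
  rw [← sup_eq_right, ← mkQ_sup, sup_eq_right.2 h]

theorem exists_nonneg_mkQ_eq (hJ : IsClosedIdeal J) :
    letI := quotientLattice hJ
    ∀ x : E ⧸ J, 0 ≤ x → ∃ a : E, 0 ≤ a ∧ J.mkQ a = x := by
  let := quotientLattice hJ
  intro x hx
  obtain ⟨a, rfl⟩ := J.mkQ_surjective x
  refine ⟨a ⊔ 0, le_sup_right, ?_⟩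
  rw [mkQ_sup hJ, map_zero]
  exact sup_eq_left.2 hx

theorem quotient_isOrderedAddMonoid (hJ : IsClosedIdeal J) :
    letI := quotientLattice hJ
    IsOrderedAddMonoid (E ⧸ J) := by
  let := quotientLattice hJ
  have key : ∀ a b : E ⧸ J, a ≤ b → ∀ c, c + a ≤ c + b := by
    intro a b hab c
    obtain ⟨a, rfl⟩ := J.mkQ_surjective a
    obtain ⟨b, rfl⟩ := J.mkQ_surjective b
    obtain ⟨c, rfl⟩ := J.mkQ_surjective c
    rw [← sup_eq_right] at hab ⊢
    rw [← map_add, ← map_add, ← mkQ_sup, ← add_sup, map_add, mkQ_sup hJ, hab, map_add]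
  exact
    { add_le_add_left := fun a b hab c => by
        have := key a b hab c
        simpa only [add_comm] using this }

theorem quotient_hasSolidNorm (hJ : IsClosedIdeal J) :
    letI := quotientLattice hJ
    haveI := hJ.1
    HasSolidNorm (E ⧸ J) := by
  let := quotientLattice hJ
  have := hJ.1
  have := quotient_isOrderedAddMonoid hJ
  refine ⟨fun x y hxy => le_of_forall_pos_lt_add fun ε hε => ?_⟩
  obtain ⟨b, hb, hbn⟩ := Submodule.Quotient.norm_mk_lt y hε
  obtain ⟨a, rfl⟩ := J.mkQ_surjective x
  have hb' : J.mkQ b = y := hb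
  subst hb'
  have e : J.mkQ ((a ⊓ |b|) ⊔ (-|b|)) = J.mkQ a := by
    rw [mkQ_sup hJ, mkQ_inf hJ, map_neg, mkQ_abs hJ, inf_eq_left.2 ((le_abs_self _).trans hxy),
      sup_eq_left]
    exact neg_le.1 ((neg_le_abs _).trans hxy)
  rw [← e]
  refine lt_of_le_of_lt ?_ hbn
  exact (Submodule.Quotient.norm_mk_le _ _).trans
    (norm_le_norm_of_abs_le_abs (abs_truncation_le a b))

/-- The operator induced on the quotient by an invariant subspace. -/
noncomputable def quotientOp (T : E →L[ℝ] E) (hT : InvariantUnder T J) :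
    (E ⧸ J) →L[ℝ] (E ⧸ J) :=
  J.liftQL (J.mkQL.comp T) fun x hx => by
    show J.mkQ (T x) = 0
    rw [Submodule.mkQ_apply, Submodule.Quotient.mk_eq_zero]
    exact hT x hx

theorem quotientOp_mkQ (T : E →L[ℝ] E) (hT : InvariantUnder T J) (x : E) :
    quotientOp T hT (J.mkQ x) = J.mkQ (T x) := rfl

theorem isCompactOperator_quotientOp {T : E →L[ℝ] E} (hT : InvariantUnder T J)
    (hTc : IsCompactOperator T) : IsCompactOperator (quotientOp T hT) := by
  rw [isCompactOperator_iff_exists_mem_nhds_image_subset_compact] at hTc ⊢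
  obtain ⟨U, hU, K, hK, hUK⟩ := hTc
  refine ⟨J.mkQ '' U, ?_, J.mkQ '' K, hK.image J.mkQL.continuous, ?_⟩
  · have := (J.isOpenQuotientMap_mkQL.isOpenMap).image_mem_nhds hU
    rwa [map_zero] at this
  · rintro _ ⟨_, ⟨x, hx, rfl⟩, rfl⟩
    exact ⟨T x, hUK ⟨x, hx, rfl⟩, rfl⟩

/-- If there is no closed `T`-invariant ideal strictly between `J` and the whole space, then a
positive commutator `A * T - T * A` maps into `J`. -/
theorem commutator_mem_of_quotient_irreducible [CompleteSpace E] (hJ : IsClosedIdeal J)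
    {T A : E →L[ℝ] E}
    (hT : IsPositiveOp T) (hTc : IsCompactOperator T) (hA : IsPositiveOp A)
    (hC : IsPositiveOp (A * T - T * A)) (hJT : InvariantUnder T J) (hJA : InvariantUnder A J)
    (hirr : ∀ K : Submodule ℝ E, IsClosedIdeal K → InvariantUnder T K → J ≤ K → K = J ∨ K = ⊤)
    (x : E) : (A * T - T * A) x ∈ J := by
  let := quotientLattice hJ
  have : IsClosed (J : Set E) := hJ.1
  have := quotient_isOrderedAddMonoid hJ
  have := quotient_hasSolidNorm hJ
  have hpos : ∀ {S : E →L[ℝ] E} (hSJ : InvariantUnder S J), IsPositiveOp S →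
      IsPositiveOp (quotientOp S hSJ) := by
    intro S hSJ hS x hx
    obtain ⟨a, ha, rfl⟩ := exists_nonneg_mkQ_eq hJ x hx
    rw [quotientOp_mkQ, ← map_zero J.mkQ]
    exact mkQ_le_mkQ hJ (hS a ha)
  have hcomm : ∀ x : E, (quotientOp A hJA * quotientOp T hJT
      - quotientOp T hJT * quotientOp A hJA) (J.mkQ x) = J.mkQ ((A * T - T * A) x) :=
    fun x => rfl
  have hirr' : IsIdealIrreducible (quotientOp T hJT) := by
    intro K hK hKT
    have hJK : J ≤ K.comap J.mkQ := fun x hx => by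
      rw [Submodule.mem_comap, Submodule.mkQ_apply, (Submodule.Quotient.mk_eq_zero J).2 hx]
      exact K.zero_mem
    have hcl : IsClosedIdeal (K.comap J.mkQ) :=
      ⟨hK.1.preimage J.mkQL.continuous, fun a b hab hb =>
        hK.2 _ _ (by rw [← mkQ_abs hJ, ← mkQ_abs hJ]; exact mkQ_le_mkQ hJ hab) hb⟩
    rcases hirr _ hcl (fun x hx => hKT _ hx) hJK with h | h
    · left
      rw [eq_bot_iff]
      intro y hy
      obtain ⟨a, rfl⟩ := J.mkQ_surjective y
      have : a ∈ K.comap J.mkQ := hy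
      rw [h] at this
      exact (Submodule.Quotient.mk_eq_zero J).2 this
    · right
      rw [eq_top_iff]
      intro y _
      obtain ⟨a, rfl⟩ := J.mkQ_surjective y
      have : a ∈ K.comap J.mkQ := by rw [h]; trivial
      exact this
  have hCpos : IsPositiveOp (quotientOp A hJA * quotientOp T hJT
      - quotientOp T hJT * quotientOp A hJA) := by
    intro y hy
    obtain ⟨a, ha, rfl⟩ := exists_nonneg_mkQ_eq hJ y hy
    rw [hcomm, ← map_zero J.mkQ]
    exact mkQ_le_mkQ hJ (hC a ha)
  have hzero := hirr'.commutator_eq_zero (hpos hJT hT) (isCompactOperator_quotientOp hJT hTc)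
    (hpos hJA hA) hCpos
  have := hcomm x
  rw [hzero] at this
  exact (Submodule.Quotient.mk_eq_zero J).1 this.symm

end Quotient

section Subspace

/-- A closed ideal is a sublattice. -/
@[reducible]
def idealLattice {I : Submodule ℝ E} (hI : IsClosedIdeal I) : Lattice I :=
  Subtype.lattice
    (fun a b ha hb => by
      have := sup_sub_sup_mem hI (a := a) (a' := 0) (b := b) (b' := 0) (by simpa) (by simpa)
      simpa using this)
    (fun a b ha hb => by
      have := inf_sub_inf_mem hI (a := a) (a' := 0) (b := b) (b' := 0) (by simpa) (by simpa)
      simpa using this)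

variable {I : Submodule ℝ E}

theorem ideal_isOrderedAddMonoid (hI : IsClosedIdeal I) :
    letI := idealLattice hI
    IsOrderedAddMonoid I := by
  let := idealLattice hI
  exact
    { add_le_add_left := fun a b hab c => by
        have h : (a : E) ≤ b := hab
        show ((a + c : I) : E) ≤ ((b + c : I) : E)
        push_cast
        exact add_le_add_left h (c : E) }

theorem ideal_hasSolidNorm (hI : IsClosedIdeal I) :
    letI := idealLattice hI
    HasSolidNorm I := by
  let := idealLattice hI
  refine ⟨fun x y hxy => ?_⟩
  have h : |(x : E)| ≤ |(y : E)| := hxy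
  show ‖(x : E)‖ ≤ ‖(y : E)‖
  exact norm_le_norm_of_abs_le_abs h

/-- If there is no closed `T`-invariant ideal strictly between `J` and `I`, then a positive
commutator `A * T - T * A` maps `I` into `J`. -/
theorem commutator_mem_of_gap [CompleteSpace E] (hI : IsClosedIdeal I)
    {J : Submodule ℝ E} (hJ : IsClosedIdeal J)
    (hJI : J ≤ I) {T A : E →L[ℝ] E}
    (hT : IsPositiveOp T) (hTc : IsCompactOperator T) (hA : IsPositiveOp A)
    (hC : IsPositiveOp (A * T - T * A)) (hJT : InvariantUnder T J) (hJA : InvariantUnder A J)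
    (hIT : InvariantUnder T I) (hIA : InvariantUnder A I)
    (hgap : ∀ K : Submodule ℝ E, IsClosedIdeal K → InvariantUnder T K → J ≤ K → K ≤ I →
      K = J ∨ K = I) : ∀ x ∈ I, (A * T - T * A) x ∈ J := by
  let := idealLattice hI
  have : IsClosed (I : Set E) := hI.1
  have : CompleteSpace I := hI.1.completeSpace_coe
  have := ideal_isOrderedAddMonoid hI
  have := ideal_hasSolidNorm hI
  let T' : I →L[ℝ] I := T.restrict hIT
  let A' : I →L[ℝ] I := A.restrict hIA
  have hJ' : IsClosedIdeal (J.comap I.subtype) :=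
    ⟨hJ.1.preimage I.subtypeL.continuous, fun a b hab hb => hJ.2 _ _ hab hb⟩
  intro x hx
  refine commutator_mem_of_quotient_irreducible hJ' (T := T') (A := A')
    (fun y hy => hT y hy) ?_ (fun y hy => hA y hy) (fun y hy => hC y hy)
    (fun y hy => hJT _ hy) (fun y hy => hJA _ hy) ?_ ⟨x, hx⟩
  · exact IsCompactOperator.restrict (f := (T : E →ₗ[ℝ] E)) hTc hIT hI.1
  · intro K hK hKT hJK
    have hKcl : IsClosed ((K.map I.subtype : Submodule ℝ E) : Set E) :=
      hI.1.isClosedEmbedding_subtypeVal.isClosedMap _ hK.1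
    have hle : K.map I.subtype ≤ I := Submodule.map_subtype_le I K
    have hKid : IsClosedIdeal (K.map I.subtype) := by
      refine ⟨hKcl, ?_⟩
      rintro a _ hab ⟨b, hb, rfl⟩
      have haI : a ∈ I := hI.2 _ _ hab b.2
      exact ⟨⟨a, haI⟩, hK.2 ⟨a, haI⟩ b hab hb, rfl⟩
    have hKinv : InvariantUnder T (K.map I.subtype) := by
      rintro _ ⟨b, hb, rfl⟩
      exact ⟨T' b, hKT b hb, rfl⟩
    have hJle : J ≤ K.map I.subtype := fun a ha => ⟨⟨a, hJI ha⟩, hJK ha, rfl⟩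
    have hback : K = (K.map I.subtype).comap I.subtype :=
      (Submodule.comap_map_eq_of_injective I.injective_subtype K).symm
    rcases hgap _ hKid hKinv hJle hle with h | h
    · left; rw [hback, h]
    · right; rw [hback, h]; simp

end Subspace

section Chain

/-- Every chain of submodules satisfying `Q` extends to a maximal such chain. -/
theorem exists_maximal_chain {Q : Submodule ℝ E → Prop} (c : Set (Submodule ℝ E))
    (hcQ : ∀ K ∈ c, Q K) (hc : IsChain (· ≤ ·) c) :
    ∃ M : Set (Submodule ℝ E), c ⊆ M ∧ (∀ K ∈ M, Q K) ∧ IsChain (· ≤ ·) M ∧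
      ∀ K, Q K → (∀ L ∈ M, K ≤ L ∨ L ≤ K) → K ∈ M := by
  obtain ⟨M, hcM, hM⟩ := zorn_subset_nonempty
    {M : Set (Submodule ℝ E) | (∀ K ∈ M, Q K) ∧ IsChain (· ≤ ·) M} (fun C hC hchain _ => by
      refine ⟨⋃₀ C, ⟨?_, ?_⟩, fun s hs => Set.subset_sUnion_of_mem hs⟩
      · rintro K ⟨M, hM, hK⟩
        exact (hC hM).1 K hK
      · rintro K ⟨M, hM, hK⟩ L ⟨M', hM', hL⟩ hne
        rcases hchain.total hM hM' with h | h
        · exact (hC hM').2 (h hK) hL hne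
        · exact (hC hM).2 hK (h hL) hne) c ⟨hcQ, hc⟩
  refine ⟨M, hcM, hM.prop.1, hM.prop.2, fun K hK hcomp => ?_⟩
  have hins : insert K M ∈ {M : Set (Submodule ℝ E) | (∀ K ∈ M, Q K) ∧ IsChain (· ≤ ·) M} := by
    refine ⟨?_, hM.prop.2.insert fun L hL _ => hcomp L hL⟩
    rintro L (rfl | hL)
    · exact hK
    · exact hM.prop.1 L hL
  exact hM.le_of_ge hins (Set.subset_insert K M) (Set.mem_insert K M)

theorem isClosedIdeal_sInf {s : Set (Submodule ℝ E)} (hs : ∀ K ∈ s, IsClosedIdeal K) :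
    IsClosedIdeal (sInf s) := by
  constructor
  · rw [Submodule.coe_sInf]
    exact isClosed_biInter fun K hK => (hs K hK).1
  · intro x y hxy hy
    rw [Submodule.mem_sInf] at hy ⊢
    exact fun K hK => (hs K hK).2 x y hxy (hy K hK)

theorem isClosedIdeal_closure_sSup {s : Set (Submodule ℝ E)} (hne : s.Nonempty)
    (hc : IsChain (· ≤ ·) s) (hs : ∀ K ∈ s, IsClosedIdeal K) :
    IsClosedIdeal (sSup s).topologicalClosure := by
  refine isClosedIdeal_topologicalClosure fun x y hxy hy => ?_
  rw [Submodule.mem_sSup_of_directed hne hc.directedOn] at hy ⊢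
  obtain ⟨K, hK, hyK⟩ := hy
  exact ⟨K, hK, (hs K hK).2 x y hxy hyK⟩

theorem invariantUnder_sInf {T : E →L[ℝ] E} {s : Set (Submodule ℝ E)}
    (hs : ∀ K ∈ s, InvariantUnder T K) : InvariantUnder T (sInf s) := by
  intro x hx
  rw [Submodule.mem_sInf] at hx ⊢
  exact fun K hK => hs K hK x (hx K hK)

theorem invariantUnder_closure_sSup {T : E →L[ℝ] E} {s : Set (Submodule ℝ E)}
    (hs : ∀ K ∈ s, InvariantUnder T K) : InvariantUnder T (sSup s).topologicalClosure := by
  have h : sSup s ≤ (sSup s).comap (T : E →ₗ[ℝ] E) :=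
    sSup_le fun K hK x hx => le_sSup hK (hs K hK x hx)
  intro x hx
  exact Set.MapsTo.closure (s := ((sSup s : Submodule ℝ E) : Set E))
    (t := ((sSup s : Submodule ℝ E) : Set E)) (fun y hy => h hy) T.continuous hx

/-- A chain of closed `T`-invariant ideals that cannot be refined. -/
structure IsMaximalInvariantChain (T : E →L[ℝ] E) (M : Set (Submodule ℝ E)) : Prop where
  isClosedIdeal : ∀ K ∈ M, IsClosedIdeal K
  invariantUnder : ∀ K ∈ M, InvariantUnder T K
  isChain : IsChain (· ≤ ·) M
  mem : ∀ K, IsClosedIdeal K → InvariantUnder T K → (∀ L ∈ M, K ≤ L ∨ L ≤ K) → K ∈ M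

namespace IsMaximalInvariantChain

variable {T : E →L[ℝ] E} {M : Set (Submodule ℝ E)}

theorem bot_mem (hM : IsMaximalInvariantChain T M) : ⊥ ∈ M :=
  hM.mem _ isClosedIdeal_bot (fun x hx => by simp_all) fun _ _ => Or.inl bot_le

theorem top_mem (hM : IsMaximalInvariantChain T M) : ⊤ ∈ M :=
  hM.mem _ isClosedIdeal_top (fun _ _ => trivial) fun _ _ => Or.inr le_top

/-- A cut of a maximal chain determines two of its members, and a positive commutator maps the
upper one into the lower one. -/
theorem commutator_mem_of_cut [CompleteSpace E] (hM : IsMaximalInvariantChain T M)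
    {A : E →L[ℝ] E} (hT : IsPositiveOp T) (hTc : IsCompactOperator T) (hA : IsPositiveOp A)
    (hC : IsPositiveOp (A * T - T * A)) (hMA : ∀ K ∈ M, InvariantUnder A K)
    {p : Submodule ℝ E → Prop} (hbot : p ⊥) (hp : ∀ K ∈ M, ∀ L ∈ M, K ≤ L → p L → p K) :
    (sSup {K ∈ M | p K}).topologicalClosure ≤ sInf {K ∈ M | ¬ p K} ∧
      ∀ x ∈ sInf {K ∈ M | ¬ p K},
        (A * T - T * A) x ∈ (sSup {K ∈ M | p K}).topologicalClosure := by
  set J := (sSup {K ∈ M | p K}).topologicalClosure with hJdef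
  set I := sInf {K ∈ M | ¬ p K} with hIdef
  have hne : {K ∈ M | p K}.Nonempty := ⟨⊥, hM.bot_mem, hbot⟩
  have hch : IsChain (· ≤ ·) {K ∈ M | p K} := hM.isChain.mono (Set.sep_subset _ _)
  have hJ : IsClosedIdeal J := isClosedIdeal_closure_sSup hne hch fun K hK => hM.isClosedIdeal K hK.1
  have hI : IsClosedIdeal I := isClosedIdeal_sInf fun K hK => hM.isClosedIdeal K hK.1
  have hJT : InvariantUnder T J :=
    invariantUnder_closure_sSup fun K hK => hM.invariantUnder K hK.1
  have hIT : InvariantUnder T I := invariantUnder_sInf fun K hK => hM.invariantUnder K hK.1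
  have hlow : ∀ K ∈ M, p K → K ≤ J := fun K hK hpK =>
    (le_sSup (show K ∈ {K ∈ M | p K} from ⟨hK, hpK⟩)).trans (Submodule.le_topologicalClosure _)
  have hupp : ∀ K ∈ M, ¬ p K → I ≤ K := fun K hK hpK => sInf_le ⟨hK, hpK⟩
  have hsep : ∀ K ∈ M, ∀ L ∈ M, p K → ¬ p L → K ≤ L := fun K hK L hL hpK hpL =>
    (hM.isChain.total hK hL).resolve_right fun h => hpL (hp L hL K hK h hpK)
  have hJI : J ≤ I := by
    refine le_sInf fun L hL => Submodule.topologicalClosure_minimal _ ?_ (hM.isClosedIdeal L hL.1).1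
    exact sSup_le fun K hK => hsep K hK.1 L hL.1 hK.2 hL.2
  have hbetween : ∀ K, IsClosedIdeal K → InvariantUnder T K → J ≤ K → K ≤ I → K ∈ M :=
    fun K hK hKT hJK hKI => hM.mem K hK hKT fun L hL => by
      by_cases hpL : p L
      · exact Or.inr ((hlow L hL hpL).trans hJK)
      · exact Or.inl (hKI.trans (hupp L hL hpL))
  refine ⟨hJI, ?_⟩
  refine commutator_mem_of_gap hI hJ hJI hT hTc hA hC hJT
    (invariantUnder_closure_sSup fun K hK => hMA K hK.1) hIT
    (invariantUnder_sInf fun K hK => hMA K hK.1) fun K hK hKT hJK hKI => ?_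
  have hKM := hbetween K hK hKT hJK hKI
  by_cases hpK : p K
  · exact Or.inl (le_antisymm (hlow K hKM hpK) hJK)
  · exact Or.inr (le_antisymm hKI (hupp K hKM hpK))

end IsMaximalInvariantChain

end Chain

section SpectralBound

/-- The powers of `C` restricted to `K` grow at most like `δ ^ n` for every `δ > ε`. -/
def HasGrowthBound (C : E →L[ℝ] E) (ε : ℝ) (K : Submodule ℝ E) : Prop :=
  ∀ δ > ε, ∃ B : ℝ, 0 ≤ B ∧ ∀ n : ℕ, ∀ x ∈ K, ‖(C ^ n) x‖ ≤ B * δ ^ n * ‖x‖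

theorem HasGrowthBound.mono {C : E →L[ℝ] E} {ε : ℝ} {K L : Submodule ℝ E} (hKL : K ≤ L)
    (h : HasGrowthBound C ε L) : HasGrowthBound C ε K := fun δ hδ => by
  obtain ⟨B, hB0, hB⟩ := h δ hδ
  exact ⟨B, hB0, fun n x hx => hB n x (hKL hx)⟩

theorem hasGrowthBound_bot {C : E →L[ℝ] E} {ε : ℝ} : HasGrowthBound C ε ⊥ := fun δ _ =>
  ⟨0, le_rfl, fun n x hx => by
    rw [Submodule.mem_bot] at hx
    simp [hx]⟩

theorem HasGrowthBound.extend {C : E →L[ℝ] E} {ε : ℝ} (hε : 0 < ε) {J I : Submodule ℝ E}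
    (hJI : J ≤ I) (hCI : InvariantUnder C I) (hJ : HasGrowthBound C ε J)
    (hd : ∀ x ∈ I, ‖x‖ ≤ 1 → Metric.infDist (C x) J ≤ ε) : HasGrowthBound C ε I := by
  intro δ hδ
  obtain ⟨η, hη1, hη2⟩ := exists_between hδ
  have hη0 : 0 < η := hε.trans hη1
  have hδ0 : 0 < δ := hη0.trans hη2
  obtain ⟨B, hB0, hB⟩ := hJ η hη1
  have hsplit : ∀ x ∈ I, ∃ y ∈ J, ‖C x - y‖ ≤ η * ‖x‖ := by
    intro x hx
    rcases eq_or_ne x 0 with rfl | hx0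
    · exact ⟨0, J.zero_mem, by simp⟩
    have hxn : 0 < ‖x‖ := norm_pos_iff.2 hx0
    have hnorm : ‖‖x‖⁻¹ • x‖ ≤ 1 := by
      rw [norm_smul, norm_inv, norm_norm, inv_mul_cancel₀ hxn.ne']
    have h1 := (hd (‖x‖⁻¹ • x) (I.smul_mem _ hx) hnorm).trans_lt hη1
    obtain ⟨y, hy, hyd⟩ := (Metric.infDist_lt_iff ⟨0, J.zero_mem⟩).1 h1
    refine ⟨‖x‖ • y, J.smul_mem _ hy, ?_⟩
    have e : C x - ‖x‖ • y = ‖x‖ • (C (‖x‖⁻¹ • x) - y) := by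
      rw [smul_sub, map_smul, smul_smul, mul_inv_cancel₀ hxn.ne', one_smul]
    rw [e, norm_smul, norm_norm, mul_comm, ← dist_eq_norm]
    gcongr
  set c : ℝ := ‖C‖ + η with hc
  have hc0 : 0 ≤ c := by positivity
  set D : ℝ := 1 + B * c / (δ - η) with hD
  have hδη : 0 < δ - η := sub_pos.2 hη2
  have hD0 : 0 ≤ D := by positivity
  have hDrec : B * c + η * D ≤ D * δ := by
    have : B * c ≤ D * (δ - η) := by
      rw [hD, add_mul, div_mul_cancel₀ _ hδη.ne']
      linarith
    linarith
  refine ⟨D, hD0, fun n => ?_⟩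
  induction n with
  | zero =>
    intro x _
    have hD1 : 1 ≤ D := by rw [hD]; exact le_add_of_nonneg_right (by positivity)
    simpa using le_mul_of_one_le_left (norm_nonneg x) hD1
  | succ n ih =>
    intro x hx
    obtain ⟨y, hy, hyd⟩ := hsplit x hx
    have hz : C x - y ∈ I := I.sub_mem (hCI x hx) (hJI hy)
    have hyn : ‖y‖ ≤ c * ‖x‖ := by
      have h1 : ‖y‖ ≤ ‖C x‖ + ‖C x - y‖ := by
        simpa using norm_sub_le (C x) (C x - y)
      have h2 := C.le_opNorm x
      rw [hc, add_mul]
      linarith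
    have e : (C ^ (n + 1)) x = (C ^ n) y + (C ^ n) (C x - y) := by
      rw [← map_add, add_sub_cancel, pow_succ]
      rfl
    calc ‖(C ^ (n + 1)) x‖ ≤ ‖(C ^ n) y‖ + ‖(C ^ n) (C x - y)‖ := by rw [e]; exact norm_add_le _ _
      _ ≤ B * η ^ n * ‖y‖ + D * δ ^ n * ‖C x - y‖ := add_le_add (hB n y hy) (ih _ hz)
      _ ≤ B * δ ^ n * (c * ‖x‖) + D * δ ^ n * (η * ‖x‖) := by gcongr
      _ = (B * c + η * D) * (δ ^ n * ‖x‖) := by ring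
      _ ≤ D * δ * (δ ^ n * ‖x‖) := by gcongr
      _ = D * δ ^ (n + 1) * ‖x‖ := by ring

theorem HasGrowthBound.closure_sSup {C : E →L[ℝ] E} (hCc : IsCompactOperator C) {ε : ℝ}
    (hε : 0 < ε) {s : Set (Submodule ℝ E)} (hne : s.Nonempty) (hc : IsChain (· ≤ ·) s)
    (hinv : ∀ K ∈ s, InvariantUnder C K) (hs : ∀ K ∈ s, HasGrowthBound C ε K) :
    HasGrowthBound C ε (sSup s).topologicalClosure := by
  set J := (sSup s).topologicalClosure with hJ
  have hJC : InvariantUnder C J := invariantUnder_closure_sSup hinv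
  have hcpt : IsCompact (closure (C '' Metric.closedBall (0 : E) 1)) :=
    hCc.isCompact_closure_image_closedBall (f := (C : E →ₗ[ℝ] E)) 1
  have hcpt' := hcpt.inter_right (t := (J : Set E)) (sSup s).isClosed_topologicalClosure
  have : Nonempty s := hne.to_subtype
  obtain ⟨⟨K, hK⟩, hKcov⟩ := hcpt'.elim_directed_cover
    (fun K : s => {y : E | Metric.infDist y (K : Submodule ℝ E) < ε})
    (fun K => isOpen_lt (Metric.continuous_infDist_pt _) continuous_const) (by
      rintro y ⟨-, hy⟩
      obtain ⟨z, hz, hyz⟩ := Metric.mem_closure_iff.1 hy ε hε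
      obtain ⟨K, hK, hzK⟩ := (Submodule.mem_sSup_of_directed hne hc.directedOn).1 hz
      exact Set.mem_iUnion.2 ⟨⟨K, hK⟩, (Metric.infDist_le_dist_of_mem hzK).trans_lt hyz⟩) (by
      refine hc.directed.mono_comp (rb := (· ⊆ ·))
        (g := fun K : Submodule ℝ E => {y : E | Metric.infDist y K < ε}) _ ?_
      intro K L hKL y hy
      exact (Metric.infDist_le_infDist_of_subset hKL ⟨0, K.zero_mem⟩).trans_lt hy)
  refine (hs K hK).extend hε ((le_sSup hK).trans (Submodule.le_topologicalClosure _)) hJC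
    fun x hx hx1 => (hKcov ⟨subset_closure ⟨x, by simpa using hx1, rfl⟩, hJC x hx⟩).le

theorem exists_infDist_le_of_sInf {C : E →L[ℝ] E} (hCc : IsCompactOperator C) {ε : ℝ}
    (hε : 0 < ε) {s : Set (Submodule ℝ E)} (hne : s.Nonempty) (hc : IsChain (· ≤ ·) s)
    (hcl : ∀ K ∈ s, IsClosed (K : Set E)) (hinv : ∀ K ∈ s, InvariantUnder C K) :
    ∃ K ∈ s, ∀ x ∈ K, ‖x‖ ≤ 1 → Metric.infDist (C x) (sInf s : Submodule ℝ E) ≤ ε := by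
  have hcpt : IsCompact (closure (C '' Metric.closedBall (0 : E) 1)) :=
    hCc.isCompact_closure_image_closedBall (f := (C : E →ₗ[ℝ] E)) 1
  have hcpt' := hcpt.inter_right
    (t := {y : E | ε ≤ Metric.infDist y (sInf s : Submodule ℝ E)})
    (isClosed_le continuous_const (Metric.continuous_infDist_pt _))
  have : Nonempty s := hne.to_subtype
  obtain ⟨⟨K, hK⟩, hKempty⟩ := hcpt'.elim_directed_family_closed
    (fun K : s => ((K : Submodule ℝ E) : Set E)) (fun K => hcl K K.2) (by
      rw [Set.eq_empty_iff_forall_notMem]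
      rintro y ⟨⟨-, hy⟩, hyK⟩
      have hmem : y ∈ (sInf s : Submodule ℝ E) :=
        (Submodule.mem_sInf).2 fun K hK => Set.mem_iInter.1 hyK ⟨K, hK⟩
      have h0 : Metric.infDist y (sInf s : Submodule ℝ E) = 0 :=
        Metric.infDist_zero_of_mem hmem
      have : ε ≤ Metric.infDist y (sInf s : Submodule ℝ E) := hy
      linarith) (fun K L => by
      rcases hc.total K.2 L.2 with h | h
      · exact ⟨K, subset_rfl, h⟩
      · exact ⟨L, h, subset_rfl⟩)
  refine ⟨K, hK, fun x hx hx1 => ?_⟩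
  by_contra! hlt
  have : C x ∈ (∅ : Set E) := by
    rw [← hKempty]
    exact ⟨⟨subset_closure ⟨x, by simpa using hx1, rfl⟩, hlt.le⟩, hinv K hK x hx⟩
  exact this

theorem tendsto_norm_pow_of_hasGrowthBound {C : E →L[ℝ] E}
    (h : ∀ ε > 0, HasGrowthBound C ε ⊤) :
    Tendsto (fun n : ℕ => ‖C ^ n‖ ^ (1 / (n : ℝ))) atTop (𝓝 0) := by
  rw [Metric.tendsto_atTop]
  intro ε hε
  obtain ⟨B, hB0, hB⟩ := h (ε / 8) (by positivity) (ε / 4) (by linarith)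
  have hlim : Tendsto (fun n : ℕ => B * (1 / 2 : ℝ) ^ n) atTop (𝓝 0) := by
    have := (tendsto_pow_atTop_nhds_zero_of_lt_one (r := (1 / 2 : ℝ)) (by norm_num)
      (by norm_num)).const_mul B
    simpa using this
  obtain ⟨n₀, hn₀⟩ := eventually_atTop.1 (hlim.eventually (gt_mem_nhds one_pos))
  refine ⟨max n₀ 1, fun n hn => ?_⟩
  have hn1 : n ≠ 0 := by have := (le_max_right n₀ 1).trans hn; omega
  have hnorm : ‖C ^ n‖ ≤ (ε / 2) ^ n := by
    refine ContinuousLinearMap.opNorm_le_bound _ (by positivity) fun x => ?_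
    calc ‖(C ^ n) x‖ ≤ B * (ε / 4) ^ n * ‖x‖ := hB n x trivial
      _ = B * (1 / 2) ^ n * (ε / 2) ^ n * ‖x‖ := by
        rw [show ε / 4 = 1 / 2 * (ε / 2) by ring, mul_pow]; ring
      _ ≤ 1 * (ε / 2) ^ n * ‖x‖ := by
        have := (hn₀ n ((le_max_left _ _).trans hn)).le
        gcongr
      _ = (ε / 2) ^ n * ‖x‖ := by rw [one_mul]
  rw [dist_zero_right, Real.norm_of_nonneg (by positivity)]
  calc ‖C ^ n‖ ^ (1 / (n : ℝ)) ≤ ((ε / 2) ^ n) ^ (1 / (n : ℝ)) := by gcongr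
    _ = ε / 2 := by rw [one_div, Real.pow_rpow_inv_natCast (by positivity) hn1]
    _ < ε := by linarith

/-- A compact operator mapping the upper member of each cut of the chain into the lower member is
quasi-nilpotent. -/
theorem hasGrowthBound_top_of_cuts {T C : E →L[ℝ] E} (hCc : IsCompactOperator C)
    {M : Set (Submodule ℝ E)} (hM : IsMaximalInvariantChain T M)
    (hMC : ∀ K ∈ M, InvariantUnder C K)
    (hcut : ∀ p : Submodule ℝ E → Prop, p ⊥ → (∀ K ∈ M, ∀ L ∈ M, K ≤ L → p L → p K) →
      (sSup {K ∈ M | p K}).topologicalClosure ≤ sInf {K ∈ M | ¬ p K} ∧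
      ∀ x ∈ sInf {K ∈ M | ¬ p K}, C x ∈ (sSup {K ∈ M | p K}).topologicalClosure)
    {ε : ℝ} (hε : 0 < ε) : HasGrowthBound C ε ⊤ := by
  set p := HasGrowthBound C ε with hp
  by_contra htop
  obtain ⟨hJI, hCmem⟩ := hcut p hasGrowthBound_bot fun K _ L _ hKL => HasGrowthBound.mono hKL
  have hchain : ∀ q : Submodule ℝ E → Prop, IsChain (· ≤ ·) {K ∈ M | q K} := fun q =>
    hM.isChain.mono (Set.sep_subset _ _)
  have hJ : HasGrowthBound C ε (sSup {K ∈ M | p K}).topologicalClosure :=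
    HasGrowthBound.closure_sSup hCc hε ⟨⊥, hM.bot_mem, hasGrowthBound_bot⟩ (hchain p)
      (fun K hK => hMC K hK.1) fun K hK => hK.2
  have hI : HasGrowthBound C ε (sInf {K ∈ M | ¬ p K}) := by
    refine hJ.extend hε hJI (fun x hx => hJI (hCmem x hx)) fun x hx _ => ?_
    rw [Metric.infDist_zero_of_mem (hCmem x hx)]
    exact hε.le
  obtain ⟨K, hK, hKd⟩ := exists_infDist_le_of_sInf hCc hε (s := {K ∈ M | ¬ p K})
    ⟨⊤, hM.top_mem, htop⟩ (hchain _) (fun K hK => (hM.isClosedIdeal K hK.1).1)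
    fun K hK => hMC K hK.1
  exact hK.2 (hI.extend hε (sInf_le hK) (hMC K hK.1) hKd)

end SpectralBound

end BanachLattice

/-- If `A` and `B` are positive compact operators on a Banach lattice `E`
with positive commutator `C = A B - B A`, then `C` is quasi-nilpotent and
ideal-triangularizable. -/
theorem stmt4 {E : Type*} [NormedAddCommGroup E] [Lattice E] [HasSolidNorm E] [IsOrderedAddMonoid E] [NormedSpace ℝ E] [CompleteSpace E]
    (A B : E →L[ℝ] E)
    (hA : ∀ x : E, 0 ≤ x → 0 ≤ A x)
    (hB : ∀ x : E, 0 ≤ x → 0 ≤ B x)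
    (hAc : IsCompactOperator ⇑A)
    (hBc : IsCompactOperator ⇑B)
    (hC : ∀ x : E, 0 ≤ x → 0 ≤ (A * B - B * A) x) :
    Tendsto (fun n : ℕ => ‖(A * B - B * A) ^ n‖ ^ (1 / (n : ℝ))) atTop (𝓝 0) ∧
    ∃ 𝒞 : Set (Submodule ℝ E),
      (∀ I ∈ 𝒞, IsClosedIdeal I) ∧
      (∀ I ∈ 𝒞, InvariantUnder (A * B - B * A) I) ∧
      IsChain (· ≤ ·) 𝒞 ∧
      (∀ 𝒟 : Set (Submodule ℝ E), (∀ I ∈ 𝒟, IsClosedIdeal I) → IsChain (· ≤ ·) 𝒟 →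
        𝒞 ⊆ 𝒟 → 𝒟 = 𝒞) := by
  set C := A * B - B * A with hCdef
  set T := A + B with hTdef
  have hT : IsPositiveOp T := IsPositiveOp.add hA hB
  have hTc : IsCompactOperator T := hAc.add hBc
  have hCT : A * T - T * A = C := by rw [hTdef, hCdef, mul_add, add_mul]; abel
  have hCpos : IsPositiveOp (A * T - T * A) := by rw [hCT]; exact hC
  have hCc : IsCompactOperator C :=
    (hAc.comp_clm B).sub (hBc.comp_clm A)
  obtain ⟨M, -, hMQ, hMchain, hMmax⟩ := exists_maximal_chain
    (Q := fun K : Submodule ℝ E => IsClosedIdeal K ∧ InvariantUnder T K) ∅ (by simp)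
    IsChain.empty
  have hM : IsMaximalInvariantChain T M :=
    ⟨fun K hK => (hMQ K hK).1, fun K hK => (hMQ K hK).2, hMchain,
      fun K hK hKT => hMmax K ⟨hK, hKT⟩⟩
  have hMA : ∀ K ∈ M, InvariantUnder A K := fun K hK =>
    (hM.isClosedIdeal K hK).invariantUnder_of_le hA
      (by rw [hTdef, add_sub_cancel_left]; exact hB) (hM.invariantUnder K hK)
  have hMB : ∀ K ∈ M, InvariantUnder B K := fun K hK =>
    (hM.isClosedIdeal K hK).invariantUnder_of_le hB
      (by rw [hTdef, add_sub_cancel_right]; exact hA) (hM.invariantUnder K hK)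
  have hMC : ∀ K ∈ M, InvariantUnder C K := fun K hK x hx =>
    K.sub_mem (hMA K hK _ (hMB K hK x hx)) (hMB K hK _ (hMA K hK x hx))
  have hcut := fun (p : Submodule ℝ E → Prop) (h1 : p ⊥)
    (h2 : ∀ K ∈ M, ∀ L ∈ M, K ≤ L → p L → p K) =>
      hCT ▸ (hM.commutator_mem_of_cut hT hTc hA hCpos hMA h1 h2)
  refine ⟨tendsto_norm_pow_of_hasGrowthBound fun ε hε =>
    hasGrowthBound_top_of_cuts hCc hM hMC hcut hε, ?_⟩
  obtain ⟨F, hMF, hFQ, hFchain, hFmax⟩ := exists_maximal_chain M hM.isClosedIdeal hMchain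
  refine ⟨F, hFQ, fun D hD x hx => ?_, hFchain, fun 𝒟 h𝒟 h𝒟chain hF𝒟 => ?_⟩
  · have hDle : D ≤ sInf {K ∈ M | ¬ K ≤ D} := le_sInf fun K hK =>
      (hFchain.total hD (hMF hK.1)).resolve_right hK.2
    have hle : (sSup {K ∈ M | K ≤ D}).topologicalClosure ≤ D :=
      Submodule.topologicalClosure_minimal _ (sSup_le fun K hK => hK.2) (hFQ D hD).1
    exact hle ((hcut (fun K => K ≤ D) bot_le fun K _ L _ hKL hLD => hKL.trans hLD).2 x (hDle hx))
  · refine (Set.Subset.antisymm hF𝒟 fun K hK => ?_).symm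
    exact hFmax K (h𝒟 K hK) fun L hL => h𝒟chain.total hK (hF𝒟 hL)
end

section
/- Let A and B be bounded linear operators on a complex Banach space X such that the product AB is power-compact. Then the product BA is power-compact, and for every nonzero complex number λ the algebraic multiplicities of λ as an eigenvalue of AB and of BA coincide: the (finite) dimension of the generalized eigenspace ⋃_{k≥1} ker((λ·I − AB)^k) equals the dimension of ⋃_{k≥1} ker((λ·I − BA)^k). -/
open Module End

/-- If `u : M → N` intertwines `f` and `g`, it maps generalized eigenspaces into generalized
eigenspaces. -/
theorem LinearMap.mapsTo_maxGenEigenspace_of_comp_eq {R M N : Type*} [CommRing R]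
    [AddCommGroup M] [Module R M] [AddCommGroup N] [Module R N] {f : End R M} {g : End R N}
    {u : M →ₗ[R] N} (h : u ∘ₗ f = g ∘ₗ u) (μ : R) {x : M} (hx : x ∈ f.maxGenEigenspace μ) :
    u x ∈ g.maxGenEigenspace μ := by
  rw [mem_maxGenEigenspace] at hx ⊢
  obtain ⟨k, hk⟩ := hx
  have hcomm : u ∘ₗ (f - μ • 1) = (g - μ • 1) ∘ₗ u := by
    ext y
    simpa using LinearMap.congr_fun h y
  have hpow : ((g - μ • 1) ^ k) ∘ₗ u = u ∘ₗ ((f - μ • 1) ^ k) :=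
    Module.End.commute_pow_left_of_commute hcomm.symm k
  refine ⟨k, ?_⟩
  rw [← LinearMap.comp_apply, hpow, LinearMap.comp_apply, hk, map_zero]

/-- An endomorphism is injective on each of its generalized eigenspaces for a nonzero scalar. -/
theorem Module.End.eq_zero_of_mem_maxGenEigenspace {R M : Type*} [CommRing R] [IsDomain R]
    [AddCommGroup M] [Module R M] [IsTorsionFree R M] {f : End R M} {μ : R} (hμ : μ ≠ 0)
    {x : M} (hx : x ∈ f.maxGenEigenspace μ) (hfx : f x = 0) : x = 0 := by
  have h0 : x ∈ f.maxGenEigenspace 0 :=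
    (mem_maxGenEigenspace f 0 x).2 ⟨1, by simpa using hfx⟩
  exact Submodule.disjoint_def.1 (disjoint_genEigenspace f hμ ⊤ ⊤) x hx h0

theorem LinearMap.finrank_maxGenEigenspace_comp_le {K M N : Type*} [Field K]
    [AddCommGroup M] [Module K M] [AddCommGroup N] [Module K N] (a : N →ₗ[K] M) (b : M →ₗ[K] N)
    {μ : K} (hμ : μ ≠ 0) [FiniteDimensional K (End.maxGenEigenspace (b ∘ₗ a) μ)] :
    finrank K (End.maxGenEigenspace (a ∘ₗ b) μ) ≤ finrank K (End.maxGenEigenspace (b ∘ₗ a) μ) := by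
  have hmaps : ∀ x ∈ End.maxGenEigenspace (a ∘ₗ b) μ, b x ∈ End.maxGenEigenspace (b ∘ₗ a) μ :=
    fun x hx => mapsTo_maxGenEigenspace_of_comp_eq (LinearMap.comp_assoc b a b).symm μ hx
  refine LinearMap.finrank_le_finrank_of_injective (f := b.restrict hmaps) ?_
  rw [injective_iff_map_eq_zero]
  rintro ⟨x, hx⟩ hbx
  have hbx : b x = 0 := congrArg Subtype.val hbx
  simpa using eq_zero_of_mem_maxGenEigenspace hμ hx (by simp [hbx])

theorem Module.End.maxGenEigenspace_le_maxGenEigenspace_pow {R M : Type*} [CommRing R]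
    [AddCommGroup M] [Module R M] (f : End R M) (μ : R) (n : ℕ) :
    f.maxGenEigenspace μ ≤ (f ^ n).maxGenEigenspace (μ ^ n) := by
  intro x hx
  rw [mem_maxGenEigenspace] at hx ⊢
  obtain ⟨k, hk⟩ := hx
  have hcomm : Commute f (μ • 1) := (Commute.one_right f).smul_right μ
  have hfac := hcomm.mul_geom_sum₂ n
  rw [smul_pow, one_pow] at hfac
  set q := ∑ i ∈ Finset.range n, f ^ i * (μ • 1) ^ (n - 1 - i)
  have hq : Commute (f - μ • 1) q := by
    refine Commute.sum_right _ _ _ fun i _ => Commute.mul_right (Commute.pow_right ?_ _)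
      (Commute.pow_right ?_ _)
    · exact (Commute.refl f).sub_left hcomm.symm
    · exact (Commute.one_right _).smul_right μ
  refine ⟨k, ?_⟩
  rw [← hfac, hq.mul_pow, (hq.pow_pow k k).eq, Module.End.mul_apply, hk, map_zero]

namespace IsCompactOperator

variable {𝕜 E : Type*} [NontriviallyNormedField 𝕜] [NormedAddCommGroup E] [NormedSpace 𝕜 E]
  {T : E →L[𝕜] E} {μ : 𝕜}

/-- If `T` is compact and `μ ≠ 0`, then `T - μ • 1` has finite ascent. -/
theorem exists_ker_pow_eq_ker_pow_succ (hT : IsCompactOperator T) (hμ : μ ≠ 0) :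
    ∃ n : ℕ, LinearMap.ker (((T : End 𝕜 E) - μ • 1) ^ n) =
      LinearMap.ker (((T : End 𝕜 E) - μ • 1) ^ (n + 1)) := by
  by_contra! hne
  obtain ⟨c, hc⟩ := NormedField.exists_one_lt_norm 𝕜
  have hμ' : 0 < ‖μ‖ := norm_pos_iff.2 hμ
  let S : E →L[𝕜] E := T - μ • 1
  let V (n : ℕ) : Submodule 𝕜 E := LinearMap.ker (((T : End 𝕜 E) - μ • 1) ^ n)
  have hV_mono : Monotone V := ((T : End 𝕜 E) - μ • 1).iterateKer.monotone
  have hV_closed (n : ℕ) : IsClosed (V n : Set E) := by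
    have : V n = LinearMap.ker (S ^ n).toLinearMap := by
      simp [V, S, ContinuousLinearMap.toLinearMap_pow]
    rw [this]
    exact (S ^ n).isClosed_ker
  have hS {n : ℕ} {x : E} (hx : x ∈ V (n + 1)) : T x - μ • x ∈ V n := by
    simpa [V, pow_succ] using hx
  have hex (n : ℕ) : ∃ x ∈ V (n + 1), ‖x‖ ≤ ‖c‖ + 1 ∧ ∀ y ∈ V n, 1 ≤ ‖x - y‖ := by
    have hlt : V n < V (n + 1) := lt_of_le_of_ne (hV_mono n.le_succ) (hne n)
    obtain ⟨z, hz, hzn⟩ := SetLike.exists_of_lt hlt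
    have hcl : IsClosed (((V n).comap (V (n + 1)).subtype : Submodule 𝕜 (V (n + 1))) :
        Set (V (n + 1))) := (hV_closed n).preimage continuous_subtype_val
    obtain ⟨⟨x, hx⟩, hxn, hxy⟩ := riesz_lemma_of_norm_lt hc (lt_add_one ‖c‖) hcl ⟨⟨z, hz⟩, hzn⟩
    exact ⟨x, hx, hxn, fun y hy => hxy ⟨y, hV_mono n.le_succ hy⟩ hy⟩
  choose f hf_mem hf_le hf_far using hex
  have hsep {m n : ℕ} (hmn : m < n) : ‖μ‖ ≤ ‖T (f n) - T (f m)‖ := by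
    have hfm : f m ∈ V n := hV_mono hmn (hf_mem m)
    have hTm : T (f m) ∈ V n := by
      have := (V n).add_mem (hS (hV_mono n.le_succ hfm)) ((V n).smul_mem μ hfm)
      simpa using this
    let u : E := μ⁻¹ • (T (f m) - (T (f n) - μ • f n))
    have hu : u ∈ V n := (V n).smul_mem _ ((V n).sub_mem hTm (hS (hf_mem n)))
    have heq : T (f n) - T (f m) = μ • (f n - u) := by
      rw [smul_sub, smul_inv_smul₀ hμ]
      abel
    rw [heq, norm_smul]
    exact le_mul_of_one_le_right hμ'.le (hf_far n u hu)
  obtain ⟨K, hK, hK'⟩ := image_closedBall_subset_compact (f := (T : E →ₗ[𝕜] E)) hT (‖c‖ + 1)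
  obtain ⟨y, -, ψ, hψ, hψy⟩ :=
    hK.tendsto_subseq (x := fun n => T (f n)) fun n => hK' ⟨f n, by simp [hf_le], rfl⟩
  obtain ⟨N, hN⟩ := Metric.cauchySeq_iff'.1 hψy.cauchySeq ‖μ‖ hμ'
  have hlt : ‖T (f (ψ (N + 1))) - T (f (ψ N))‖ < ‖μ‖ := by
    simpa [dist_eq_norm_sub] using hN (N + 1) N.le_succ
  exact hlt.not_ge (hsep (hψ N.lt_succ_self))

/-- If `T` is compact and `μ ≠ 0`, then the kernels of the powers of `T - μ • 1` are
finite-dimensional. -/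
theorem finiteDimensional_ker_sub_smul_pow [CompleteSpace 𝕜] (hT : IsCompactOperator T)
    (hμ : μ ≠ 0) (n : ℕ) :
    FiniteDimensional 𝕜 (LinearMap.ker ((T - μ • 1) ^ n).toLinearMap) := by
  set V := LinearMap.ker ((T - μ • 1) ^ n).toLinearMap
  have hcomm : Commute (T - μ • 1) (-μ • (1 : E →L[𝕜] E)) :=
    (Commute.one_right _).smul_right _
  obtain ⟨q, hq⟩ := hcomm.sub_dvd_pow_sub_pow n
  have hTq : (T - μ • 1) ^ n - (-μ) ^ n • 1 = T * q := by
    rw [smul_pow, one_pow] at hq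
    simpa using hq
  have hν : (-μ) ^ n ≠ 0 := pow_ne_zero _ (neg_ne_zero.2 hμ)
  have hid (x : V) : -((-μ) ^ n)⁻¹ • T (q x) = x := by
    have h := congrArg (fun F : E →L[𝕜] E => F x) hTq
    have hx : ((T - μ • 1) ^ n) (x : E) = 0 := x.2
    simp only [sub_apply, hx, zero_sub, smul_apply, one_apply_eq_self, mul_apply_eq_comp] at h
    rw [← h, smul_neg, neg_smul, neg_neg, inv_smul_smul₀ hν]
  have hcompact : IsCompactOperator (fun x : V => -((-μ) ^ n)⁻¹ • T (q x)) :=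
    (hT.comp_clm (q ∘L V.subtypeL)).smul (-((-μ) ^ n)⁻¹)
  have hmem (x : V) : -((-μ) ^ n)⁻¹ • T (q x) ∈ V := by
    rw [hid]
    exact x.2
  have hres := hcompact.codRestrict hmem ((T - μ • 1) ^ n).isClosed_ker
  refine FiniteDimensional.of_isCompactOperator_id (𝕜 := 𝕜) (E := V) ?_
  have heq : Set.codRestrict (fun x : V => -((-μ) ^ n)⁻¹ • T (q x)) V hmem = id :=
    funext fun x => Subtype.ext (hid x)
  rwa [heq] at hres

/-- The generalized eigenspaces of a compact operator for nonzero scalars are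
finite-dimensional. -/
theorem finiteDimensional_maxGenEigenspace [CompleteSpace 𝕜] (hT : IsCompactOperator T)
    (hμ : μ ≠ 0) : FiniteDimensional 𝕜 (End.maxGenEigenspace (T : End 𝕜 E) μ) := by
  obtain ⟨n, hn⟩ := exists_ker_pow_eq_ker_pow_succ hT hμ
  have := finiteDimensional_ker_sub_smul_pow hT hμ n
  refine Submodule.finiteDimensional_of_le
    (S₂ := LinearMap.ker ((T - μ • 1) ^ n).toLinearMap) fun x hx => ?_
  obtain ⟨k, hk⟩ := (mem_maxGenEigenspace _ _ _).1 hx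
  have hx' : x ∈ LinearMap.ker (((T : End 𝕜 E) - μ • 1) ^ (n + k)) := by
    rw [LinearMap.mem_ker, pow_add, Module.End.mul_apply, hk, map_zero]
  rw [← ker_pow_constant hn k] at hx'
  simpa [ContinuousLinearMap.toLinearMap_pow] using hx'

/-- The generalized eigenspaces of a power-compact operator for nonzero scalars are
finite-dimensional. -/
theorem finiteDimensional_maxGenEigenspace_of_pow [CompleteSpace 𝕜] {n : ℕ}
    (hT : IsCompactOperator (T ^ n)) (hμ : μ ≠ 0) :
    FiniteDimensional 𝕜 (End.maxGenEigenspace (T : End 𝕜 E) μ) := by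
  have := finiteDimensional_maxGenEigenspace hT (pow_ne_zero n hμ)
  refine Submodule.finiteDimensional_of_le (S₂ := End.maxGenEigenspace (T ^ n).toLinearMap (μ ^ n)) ?_
  rw [ContinuousLinearMap.toLinearMap_pow]
  exact maxGenEigenspace_le_maxGenEigenspace_pow _ μ n

/-- If `(A * B) ^ n` is compact, then so is `(B * A) ^ (n + 1)`. -/
theorem mul_pow_succ_swap {A B : E →L[𝕜] E} {n : ℕ} (h : IsCompactOperator ((A * B) ^ n)) :
    IsCompactOperator ((B * A) ^ (n + 1)) := by
  have heq : (B * A) ^ (n + 1) = B * (A * B) ^ n * A := by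
    rw [pow_succ, ← mul_assoc, mul_pow_mul]
  rw [heq]
  exact (h.comp_clm A).clm_comp B

end IsCompactOperator

theorem ContinuousLinearMap.iSup_ker_smul_one_sub_pow_succ {𝕜 E : Type*}
    [NontriviallyNormedField 𝕜] [NormedAddCommGroup E] [NormedSpace 𝕜 E] (T : E →L[𝕜] E) (μ : 𝕜) :
    ⨆ k : ℕ, LinearMap.ker ((μ • (1 : E →L[𝕜] E) - T) ^ (k + 1)).toLinearMap =
      End.maxGenEigenspace (T : End 𝕜 E) μ := by
  have hker (k : ℕ) : LinearMap.ker ((μ • (1 : E →L[𝕜] E) - T) ^ k).toLinearMap =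
      End.genEigenspace (T : End 𝕜 E) μ k := by
    have hneg : ((μ • (1 : E →L[𝕜] E) - T) ^ k).toLinearMap =
        (-((T : End 𝕜 E) - μ • 1)) ^ k := by
      rw [ContinuousLinearMap.toLinearMap_pow, neg_sub]
      rfl
    ext x
    rw [genEigenspace_nat, hneg, neg_pow]
    rcases neg_one_pow_eq_or (End 𝕜 E) k with h | h <;> simp [h]
  simp_rw [hker, ← iSup_genEigenspace_eq]
  exact Monotone.iSup_nat_add
    (fun m n h => (End.genEigenspace (T : End 𝕜 E) μ).monotone (by exact_mod_cast h)) 1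

/-- Pietsch's principle of related operators: if `A B` is power-compact on a
complex Banach space `X`, then `B A` is power-compact and for every nonzero `λ ∈ ℂ` the
generalized eigenspaces `⋃_{k ≥ 1} ker((λ·I - A B)^k)` and `⋃_{k ≥ 1} ker((λ·I - B A)^k)`
are finite-dimensional of equal dimension. -/
theorem stmt5 {X : Type*} [NormedAddCommGroup X] [NormedSpace ℂ X] [CompleteSpace X]
    (A B : X →L[ℂ] X)
    (hAB : ∃ n : ℕ, 1 ≤ n ∧ IsCompactOperator ⇑((A * B) ^ n)) :
    (∃ n : ℕ, 1 ≤ n ∧ IsCompactOperator ⇑((B * A) ^ n)) ∧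
    ∀ lam : ℂ, lam ≠ 0 →
      FiniteDimensional ℂ
        ↥(⨆ k : ℕ, LinearMap.ker ((lam • (1 : X →L[ℂ] X) - A * B) ^ (k + 1)).toLinearMap) ∧
      FiniteDimensional ℂ
        ↥(⨆ k : ℕ, LinearMap.ker ((lam • (1 : X →L[ℂ] X) - B * A) ^ (k + 1)).toLinearMap) ∧
      Module.finrank ℂ
          ↥(⨆ k : ℕ, LinearMap.ker ((lam • (1 : X →L[ℂ] X) - A * B) ^ (k + 1)).toLinearMap) =
        Module.finrank ℂ
          ↥(⨆ k : ℕ, LinearMap.ker ((lam • (1 : X →L[ℂ] X) - B * A) ^ (k + 1)).toLinearMap) := by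
  obtain ⟨n, -, hn⟩ := hAB
  have hBA := IsCompactOperator.mul_pow_succ_swap hn
  refine ⟨⟨n + 1, n.succ_pos, hBA⟩, fun lam hlam => ?_⟩
  rw [ContinuousLinearMap.iSup_ker_smul_one_sub_pow_succ (A * B) lam,
    ContinuousLinearMap.iSup_ker_smul_one_sub_pow_succ (B * A) lam]
  have h₁ := IsCompactOperator.finiteDimensional_maxGenEigenspace_of_pow hn hlam
  have h₂ := IsCompactOperator.finiteDimensional_maxGenEigenspace_of_pow hBA hlam
  have : FiniteDimensional ℂ (End.maxGenEigenspace (A.toLinearMap ∘ₗ B.toLinearMap) lam) := h₁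
  have : FiniteDimensional ℂ (End.maxGenEigenspace (B.toLinearMap ∘ₗ A.toLinearMap) lam) := h₂
  exact ⟨h₁, h₂, le_antisymm
    (LinearMap.finrank_maxGenEigenspace_comp_le A.toLinearMap B.toLinearMap hlam)
    (LinearMap.finrank_maxGenEigenspace_comp_le B.toLinearMap A.toLinearMap hlam)⟩
end

section
/- Let A and B be positive bounded linear operators on a Banach lattice E such that the commutator AB − BA is a positive operator. Then for every natural number n ≥ 1 one has 0 ≤ (AB)ⁿ ≤ AⁿBⁿ, i.e., (AB)ⁿ is a positive operator and AⁿBⁿ − (AB)ⁿ is a positive operator. -/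
section PositiveOperators

variable {E : Type*} [NormedAddCommGroup E] [PartialOrder E] [NormedSpace ℝ E]

theorem ContinuousLinearMap.pow_apply_nonneg {T : E →L[ℝ] E} (hT : ∀ x : E, 0 ≤ x → 0 ≤ T x)
    (n : ℕ) : ∀ x : E, 0 ≤ x → 0 ≤ (T ^ n) x := by
  induction n with
  | zero => intro x hx; simpa using hx
  | succ n ih => intro x hx; rw [pow_succ]; exact ih _ (hT x hx)

variable [IsOrderedAddMonoid E]

theorem ContinuousLinearMap.monotone_of_nonneg {T : E →L[ℝ] E} (hT : ∀ x : E, 0 ≤ x → 0 ≤ T x) :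
    Monotone T := fun x y h => by
  simpa using hT (y - x) (sub_nonneg.2 h)

theorem ContinuousLinearMap.apply_pow_le_pow_apply {A B : E →L[ℝ] E}
    (hA : ∀ x : E, 0 ≤ x → 0 ≤ A x) (hC : ∀ x : E, 0 ≤ x → B (A x) ≤ A (B x)) (n : ℕ) :
    ∀ x : E, 0 ≤ x → B ((A ^ n) x) ≤ (A ^ n) (B x) := by
  induction n with
  | zero => intro x _; simp
  | succ n ih =>
    intro x hx
    rw [pow_succ]
    exact (ih _ (hA x hx)).trans (monotone_of_nonneg (pow_apply_nonneg hA n) (hC x hx))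

theorem ContinuousLinearMap.mul_pow_apply_le {A B : E →L[ℝ] E}
    (hA : ∀ x : E, 0 ≤ x → 0 ≤ A x) (hB : ∀ x : E, 0 ≤ x → 0 ≤ B x)
    (hC : ∀ x : E, 0 ≤ x → B (A x) ≤ A (B x)) (n : ℕ) :
    ∀ x : E, 0 ≤ x → ((A * B) ^ n) x ≤ (A ^ n) ((B ^ n) x) := by
  induction n with
  | zero => intro x _; simp
  | succ n ih =>
    intro x hx
    rw [pow_succ' (A * B), pow_succ' A, pow_succ' B]
    exact monotone_of_nonneg hA <| (monotone_of_nonneg hB (ih x hx)).trans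
      (apply_pow_le_pow_apply hA hC n _ (pow_apply_nonneg hB n x hx))

end PositiveOperators

/-- If `A` and `B` are positive operators on a Banach lattice `E` with positive
commutator `A B - B A`, then `0 ≤ (A B)ⁿ ≤ AⁿBⁿ` for every `n ≥ 1`. -/
theorem stmt7 {E : Type*} [NormedAddCommGroup E] [Lattice E] [HasSolidNorm E] [IsOrderedAddMonoid E] [NormedSpace ℝ E] [CompleteSpace E]
    (A B : E →L[ℝ] E)
    (hA : ∀ x : E, 0 ≤ x → 0 ≤ A x)
    (hB : ∀ x : E, 0 ≤ x → 0 ≤ B x)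
    (hC : ∀ x : E, 0 ≤ x → 0 ≤ (A * B - B * A) x) :
    ∀ n : ℕ, 1 ≤ n →
      (∀ x : E, 0 ≤ x → 0 ≤ ((A * B) ^ n) x) ∧
      (∀ x : E, 0 ≤ x → 0 ≤ (A ^ n * B ^ n - (A * B) ^ n) x) := by
  have hC' : ∀ x : E, 0 ≤ x → B (A x) ≤ A (B x) := fun x hx => sub_nonneg.1 (hC x hx)
  intro n _
  exact ⟨ContinuousLinearMap.pow_apply_nonneg (T := A * B) (fun x hx => hA _ (hB x hx)) n,
    fun x hx => sub_nonneg.2 (ContinuousLinearMap.mul_pow_apply_le hA hB hC' n x hx)⟩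
end
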